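/- There is a computable age 𝕂, which is the canonical computable age of some computable structure (in a computable language that may be infinite), such that 𝕂 has coAP but for every Turing degree s, if 𝕂 has CcoAP(s) then 0'' ≤_T s. -/

import Mathlib

/- Self-contained framework for computable ages and cofinal Fraïssé limits. -/

namespace CFL

open Classical

/-! ### Oracle computability -/

/-- The characteristic partial function of a set of naturals. -/
noncomputable def chi (A : Set ℕ) : ℕ →. ℕ :=
  fun n => Part.some (if n ∈ A then 1 else 0)

/-- Codes for oracle partial recursive functions. -/
inductive OCode : Type
  | zero : OCode
  | succ : OCode
  | left : OCode
  | right : OCode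
  | oracle : OCode
  | pair : OCode → OCode → OCode
  | comp : OCode → OCode → OCode
  | prec : OCode → OCode → OCode
  | rfind' : OCode → OCode

/-- Evaluation of an oracle code relative to an oracle `O`. -/
def OCode.eval (O : ℕ →. ℕ) : OCode → ℕ →. ℕ
  | OCode.zero => pure 0
  | OCode.succ => Nat.succ
  | OCode.left => ↑fun n : ℕ => n.unpair.1
  | OCode.right => ↑fun n : ℕ => n.unpair.2
  | OCode.oracle => O
  | OCode.pair cf cg => fun n => Nat.pair <$> OCode.eval O cf n <*> OCode.eval O cg n
  | OCode.comp cf cg => fun n => OCode.eval O cg n >>= OCode.eval O cf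
  | OCode.prec cf cg =>
    Nat.unpaired fun a n =>
      n.rec (OCode.eval O cf a) fun y IH => do
        let i ← IH
        OCode.eval O cg (Nat.pair a (Nat.pair y i))
  | OCode.rfind' cf =>
    Nat.unpaired fun a m =>
      (Nat.rfind fun n => (fun m => m = 0) <$> OCode.eval O cf (Nat.pair a (n + m))).map
        (· + m)

/-- A numerical code of an `OCode`. -/
def OCode.encodeCode : OCode → ℕ
  | OCode.zero => 0
  | OCode.succ => 1
  | OCode.left => 2
  | OCode.right => 3
  | OCode.oracle => 4
  | OCode.pair cf cg => 4 * Nat.pair cf.encodeCode cg.encodeCode + 5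
  | OCode.comp cf cg => 4 * Nat.pair cf.encodeCode cg.encodeCode + 6
  | OCode.prec cf cg => 4 * Nat.pair cf.encodeCode cg.encodeCode + 7
  | OCode.rfind' cf => 4 * cf.encodeCode + 8

/-- `f` is a partial function recursive in the oracle set `O`. -/
def RecFunIn (O : Set ℕ) (f : ℕ →. ℕ) : Prop :=
  ∃ c : OCode, OCode.eval (chi O) c = f

/-- The code `c` computes the total function `f` relative to the oracle set `O`. -/
def ComputesIn (O : Set ℕ) (c : OCode) (f : ℕ → ℕ) : Prop :=
  ∀ n, OCode.eval (chi O) c n = Part.some (f n)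

/-- `f` is a total function computable in the oracle set `O`. -/
def TotalComputableIn (O : Set ℕ) (f : ℕ → ℕ) : Prop :=
  ∃ c : OCode, ComputesIn O c f

/-- The set `A` is computable in the oracle set `O`. -/
def SetRecIn (O A : Set ℕ) : Prop := RecFunIn O (chi A)

/-- Turing reducibility (on sets of naturals, regarded as representatives of
Turing degrees). -/
def TuringLE (A B : Set ℕ) : Prop := SetRecIn B A

/-- The set `A` is computably enumerable in the oracle set `O`. -/
def CEIn (O A : Set ℕ) : Prop :=
  ∃ c : OCode, ∀ n, n ∈ A ↔ (OCode.eval (chi O) c n).Dom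

/-- The Turing jump of a set of naturals. -/
def jump (O : Set ℕ) : Set ℕ :=
  { e | ∃ c : OCode, c.encodeCode = (Nat.unpair e).1 ∧
      (OCode.eval (chi O) c (Nat.unpair e).2).Dom }

/-- `0'`, the jump of the least degree. -/
def zeroJump : Set ℕ := jump ∅

/-- `0''`. -/
def zeroJump2 : Set ℕ := jump zeroJump

/-- `0'''`. -/
def zeroJump3 : Set ℕ := jump zeroJump2

/-! ### Languages and structures -/

/-- A (coded) first-order language: `relArity r = some k` means that `r` is the code of a
relation symbol of arity `k`, and similarly for function symbols. -/
structure Lang where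
  relArity : ℕ → Option ℕ
  funArity : ℕ → Option ℕ

/-- The language is computably represented. -/
def Lang.ComputableRep (L : Lang) : Prop :=
  TotalComputableIn ∅ (fun r => Encodable.encode (L.relArity r)) ∧
  TotalComputableIn ∅ (fun f => Encodable.encode (L.funArity f))

/-- A finite relational language. -/
def Lang.FiniteRelational (L : Lang) : Prop :=
  (∀ f, L.funArity f = none) ∧ { r | (L.relArity r).isSome = true }.Finite

/-- A finite language. -/
def Lang.FiniteLang (L : Lang) : Prop :=
  { r | (L.relArity r).isSome = true }.Finite ∧
  { f | (L.funArity f).isSome = true }.Finite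

/-- An `L`-structure with underlying set a set of naturals. -/
structure Str (L : Lang) where
  dom : Set ℕ
  rel : ℕ → List ℕ → Prop
  fn : ℕ → List ℕ → ℕ
  rel_valid : ∀ r as, rel r as → L.relArity r = some as.length ∧ ∀ x ∈ as, x ∈ dom
  fn_mem : ∀ f as, L.funArity f = some as.length → (∀ x ∈ as, x ∈ dom) → fn f as ∈ dom

variable {L : Lang}

/-- The (finite) tuple `as` lies in the structure `A`. -/
def TupleIn (A : Str L) (as : List ℕ) : Prop := ∀ x ∈ as, x ∈ A.dom

/-- Membership in the substructure of `A` generated by the tuple `s`. -/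
inductive InClosure (A : Str L) (s : List ℕ) : ℕ → Prop
  | base {x : ℕ} : x ∈ s → x ∈ A.dom → InClosure A s x
  | fn (f : ℕ) (as : List ℕ) : L.funArity f = some as.length →
      (∀ x ∈ as, InClosure A s x) → InClosure A s (A.fn f as)

theorem InClosure.mem_dom {A : Str L} {s : List ℕ} {x : ℕ}
    (h : InClosure A s x) : x ∈ A.dom := by
  induction h with
  | base _ hx => exact hx
  | fn f as ha _ ih => exact A.fn_mem f as ha ih

/-- The substructure of `A` generated by the tuple `s`. -/
def Str.sub (A : Str L) (s : List ℕ) : Str L where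
  dom := { x | InClosure A s x }
  rel r as := A.rel r as ∧ ∀ x ∈ as, InClosure A s x
  fn := A.fn
  rel_valid := fun r as h => ⟨(A.rel_valid r as h.1).1, h.2⟩
  fn_mem := fun f as ha hm => InClosure.fn f as ha hm

/-- `h` is an embedding of `A` into `B`. -/
def IsEmbMap (A B : Str L) (h : ℕ → ℕ) : Prop :=
  (∀ x ∈ A.dom, h x ∈ B.dom) ∧
  (∀ x ∈ A.dom, ∀ y ∈ A.dom, h x = h y → x = y) ∧
  (∀ r as, TupleIn A as → (A.rel r as ↔ B.rel r (as.map h))) ∧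
  (∀ f as, L.funArity f = some as.length → TupleIn A as →
    h (A.fn f as) = B.fn f (as.map h))

/-- `A` embeds into `B`. -/
def Embeds (A B : Str L) : Prop := ∃ h, IsEmbMap A B h

/-- `h` is an isomorphism of `A` onto `B`. -/
def IsIsoMap (A B : Str L) (h : ℕ → ℕ) : Prop :=
  IsEmbMap A B h ∧ ∀ y ∈ B.dom, ∃ x ∈ A.dom, h x = y

/-- `A` and `B` are isomorphic. -/
def Isom (A B : Str L) : Prop := ∃ h, IsIsoMap A B h

/-- `as ∼cl bs`: the coordinatewise map extends to an isomorphism of generated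
substructures. -/
def ClSim (A : Str L) (as : List ℕ) (B : Str L) (bs : List ℕ) : Prop :=
  ∃ h : ℕ → ℕ, as.map h = bs ∧ IsIsoMap (A.sub as) (B.sub bs) h

/-- `as ∼tuple bs`: equal length and the same pattern of equalities among coordinates. -/
def TupleSim (as bs : List ℕ) : Prop :=
  ∃ h h' : ℕ → ℕ, as.map h = bs ∧ bs.map h' = as

/-- `A` is finitely generated. -/
def Str.FG (A : Str L) : Prop :=
  ∃ s : List ℕ, TupleIn A s ∧ ∀ x, x ∈ A.dom ↔ InClosure A s x

/-- `g` is an automorphism of `M`. -/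
def IsAutoOf (M : Str L) (g : ℕ → ℕ) : Prop := IsIsoMap M M g

/-! ### Ages (as isomorphism-closed classes) -/

/-- `B` belongs to the age of `M`, i.e. `B` is isomorphic to a finitely generated
substructure of `M`. -/
def AgeMemOf (M : Str L) (B : Str L) : Prop :=
  ∃ as : List ℕ, TupleIn M as ∧ Isom B (M.sub as)

/-- The age of a structure `M`. -/
def ageOf (M : Str L) : Set (Str L) := { B | AgeMemOf M B }

/-- The hereditary property. -/
def HP (C : Set (Str L)) : Prop :=
  ∀ B ∈ C, ∀ as : List ℕ, TupleIn B as → B.sub as ∈ C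

/-- The joint embedding property. -/
def JEP (C : Set (Str L)) : Prop :=
  ∀ A ∈ C, ∀ B ∈ C, ∃ D ∈ C, Embeds A D ∧ Embeds B D

/-- Every pair of embeddings with domain `A` into members of `C` can be amalgamated
over `A` inside `C`. -/
def AmalgamatesOver (C : Set (Str L)) (A : Str L) : Prop :=
  ∀ B₀ ∈ C, ∀ B₁ ∈ C, ∀ f₀ f₁ : ℕ → ℕ, IsEmbMap A B₀ f₀ → IsEmbMap A B₁ f₁ →
    ∃ D ∈ C, ∃ g₀ g₁ : ℕ → ℕ, IsEmbMap B₀ D g₀ ∧ IsEmbMap B₁ D g₁ ∧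
      ∀ x ∈ A.dom, g₀ (f₀ x) = g₁ (f₁ x)

/-- The amalgamation property. -/
def AP (C : Set (Str L)) : Prop := ∀ A ∈ C, AmalgamatesOver C A

/-- `A` is an amalgamation base of the class `C`. -/
def AmalgBase (C : Set (Str L)) (A : Str L) : Prop := A ∈ C ∧ AmalgamatesOver C A

/-- The cofinal amalgamation property. -/
def CoAP (C : Set (Str L)) : Prop :=
  ∀ A ∈ C, ∃ A' : Str L, AmalgBase C A' ∧ Embeds A A'

/-! ### Computable ages -/

/-- An (abstract) enumerated age: for each index `i`, a generating tuple `tup i` and the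
structure `str i` it generates. -/
structure CompAge (L : Lang) where
  tup : ℕ → List ℕ
  str : ℕ → Str L
  tup_mem : ∀ i, TupleIn (str i) (tup i)
  gen : ∀ i x, x ∈ (str i).dom ↔ InClosure (str i) (tup i) x

/-- The class of structures represented by the enumerated age `K`. -/
def CompAge.cls (K : CompAge L) : Set (Str L) := { B | ∃ i, Isom B (K.str i) }

/-- The structure `M` is computable in the oracle set `s`. -/
def StrComputableIn (s : Set ℕ) (M : Str L) : Prop :=
  SetRecIn s M.dom ∧
  SetRecIn s { p | ∃ r as, TupleIn M as ∧ M.rel r as ∧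
      p = Nat.pair r (Encodable.encode as) } ∧
  SetRecIn s { p | ∃ f as b, L.funArity f = some as.length ∧ TupleIn M as ∧
      M.fn f as = b ∧ p = Nat.pair f (Nat.pair (Encodable.encode as) b) }

/-- The coded diagram of an enumerated age. -/
def CompAge.diag (K : CompAge L) : Set ℕ :=
  { p | ∃ i, p = Nat.pair 0 (Nat.pair i (Encodable.encode (K.tup i))) } ∪
  { p | ∃ i x, x ∈ (K.str i).dom ∧ p = Nat.pair 1 (Nat.pair i x) } ∪
  { p | ∃ i r as, TupleIn (K.str i) as ∧ (K.str i).rel r as ∧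
      p = Nat.pair 2 (Nat.pair i (Nat.pair r (Encodable.encode as))) } ∪
  { p | ∃ i r as, TupleIn (K.str i) as ∧ L.relArity r = some as.length ∧
      ¬ (K.str i).rel r as ∧
      p = Nat.pair 3 (Nat.pair i (Nat.pair r (Encodable.encode as))) } ∪
  { p | ∃ i f as b, TupleIn (K.str i) as ∧ L.funArity f = some as.length ∧
      (K.str i).fn f as = b ∧
      p = Nat.pair 4 (Nat.pair i (Nat.pair f (Nat.pair (Encodable.encode as) b))) }

/-- `K` is an `s`-computable age: its diagram is c.e. in `s` and each of its structures
is computable in `s`. -/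
def AgeComputableIn (s : Set ℕ) (K : CompAge L) : Prop :=
  CEIn s K.diag ∧ ∀ i, StrComputableIn s (K.str i)

/-- The embedding information of an enumerated age, as a set of naturals. -/
def EmbedInfo (K : CompAge L) : Set ℕ :=
  { p | ∃ k₀ b₀ k₁ b₁, TupleIn (K.str k₀) b₀ ∧ TupleIn (K.str k₁) b₁ ∧
      ClSim (K.str k₀) b₀ (K.str k₁) b₁ ∧
      p = Nat.pair k₀ (Nat.pair (Encodable.encode b₀)
            (Nat.pair k₁ (Encodable.encode b₁))) }

/-! ### Potential embeddings, spans, and amalgamation diagrams -/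

/-- A potential embedding: a pair of indices and a tuple in the codomain structure. -/
structure PotEmb where
  i : ℕ
  j : ℕ
  c : List ℕ

/-- A numerical code of a potential embedding. -/
def PotEmb.code (F : PotEmb) : ℕ :=
  Nat.pair F.i (Nat.pair F.j (Encodable.encode F.c))

/-- The potential embedding is well-formed with respect to `K`. -/
def PotEmb.Valid (K : CompAge L) (F : PotEmb) : Prop :=
  F.c.length = (K.tup F.i).length ∧ TupleIn (K.str F.j) F.c

/-- The potential embedding is an embedding. -/
def PotEmb.IsEmb (K : CompAge L) (F : PotEmb) : Prop :=
  ClSim (K.str F.i) (K.tup F.i) (K.str F.j) F.c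

/-- The potential embedding is an isomorphism (its range generates the codomain). -/
def PotEmb.IsIso (K : CompAge L) (F : PotEmb) : Prop :=
  F.IsEmb K ∧ ∀ x ∈ (K.str F.j).dom, InClosure (K.str F.j) F.c x

/-- `h` realizes the potential embedding `F` as a map on the domain structure. -/
def ExtMap (K : CompAge L) (F : PotEmb) (h : ℕ → ℕ) : Prop :=
  (K.tup F.i).map h = F.c ∧ IsEmbMap (K.str F.i) (K.str F.j) h

/-- `(F₀, F₁)` is a potential span. -/
def PotSpan (K : CompAge L) (F₀ F₁ : PotEmb) : Prop :=
  F₀.Valid K ∧ F₁.Valid K ∧ F₀.i = F₁.i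

/-- `(G₀, G₁)` is an amalgamation diagram over the potential span `(F₀, F₁)`. -/
def AmalgDiagOver (K : CompAge L) (F₀ F₁ G₀ G₁ : PotEmb) : Prop :=
  G₀.Valid K ∧ G₁.Valid K ∧ G₀.IsEmb K ∧
  G₀.i = F₀.j ∧ G₁.i = F₁.j ∧ G₀.j = G₁.j ∧
  (F₀.IsEmb K → F₁.IsEmb K → G₁.IsEmb K ∧
    ∀ h₀ h₁ : ℕ → ℕ, ExtMap K G₀ h₀ → ExtMap K G₁ h₁ →
      F₀.c.map h₀ = F₁.c.map h₁)

/-- `H` is the composition `F ∘ G` of potential embeddings (where `F` is an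
embedding realized by any `h` extending it). -/
def CompRel (K : CompAge L) (F G H : PotEmb) : Prop :=
  G.j = F.i ∧ H.i = G.i ∧ H.j = F.j ∧
  ∀ h : ℕ → ℕ, ExtMap K F h → H.c = G.c.map h

/-! ### Computable versions of HP, JEP, AP, coAP -/

/-- The `s`-computable hereditary property. -/
def CHP (s : Set ℕ) (K : CompAge L) : Prop :=
  ∃ c : OCode, ∀ i (b : List ℕ), TupleIn (K.str i) b →
    ∃ j, OCode.eval (chi s) c (Nat.pair i (Encodable.encode b)) = Part.some j ∧
      ClSim (K.str j) (K.tup j) (K.str i) b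

/-- The `s`-computable joint embedding property. -/
def CJEP (s : Set ℕ) (K : CompAge L) : Prop :=
  ∃ c : OCode, ∀ i j : ℕ, ∃ F G : PotEmb,
    OCode.eval (chi s) c (Nat.pair i j) = Part.some (Nat.pair F.code G.code) ∧
    F.Valid K ∧ G.Valid K ∧ F.IsEmb K ∧ G.IsEmb K ∧
    F.i = i ∧ G.i = j ∧ F.j = G.j

/-- The `s`-computable amalgamation property. -/
def CAP (s : Set ℕ) (K : CompAge L) : Prop :=
  ∃ c : OCode, ∀ F₀ F₁ : PotEmb, PotSpan K F₀ F₁ →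
    ∃ G₀ G₁ : PotEmb,
      OCode.eval (chi s) c (Nat.pair F₀.code F₁.code) =
        Part.some (Nat.pair G₀.code G₁.code) ∧
      AmalgDiagOver K F₀ F₁ G₀ G₁

/-- A family `W` of distinguished embeddings with amalgamation-base codomains, closed
under pre/post composition with isomorphisms, covering all domains. -/
def IsCoAPFamily (K : CompAge L) (W : Set PotEmb) : Prop :=
  (∀ F ∈ W, F.Valid K ∧ F.IsEmb K ∧ AmalgBase K.cls (K.str F.j)) ∧
  (∀ F ∈ W, ∀ G H : PotEmb, G.Valid K → G.IsIso K → G.j = F.i →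
      CompRel K F G H → H ∈ W) ∧
  (∀ F ∈ W, ∀ G H : PotEmb, G.Valid K → G.IsIso K → G.i = F.j →
      CompRel K G F H → H ∈ W) ∧
  (∀ i : ℕ, ∃ F ∈ W, F.i = i)

/-- The `s`-computable cofinal amalgamation property: there is an `s`-c.e. family of
distinguished embeddings onto amalgamation bases together with an `s`-computable
amalgamation function. -/
def CcoAP (s : Set ℕ) (K : CompAge L) : Prop :=
  ∃ W : Set PotEmb, IsCoAPFamily K W ∧
    CEIn s { p | ∃ F ∈ W, p = F.code } ∧
    ∃ c : OCode, ∀ F ∈ W, ∀ G₀ G₁ : PotEmb,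
      G₀.Valid K → G₁.Valid K → G₀.i = F.j → G₁.i = F.j →
      ∃ D₀ D₁ : PotEmb,
        OCode.eval (chi s) c (Nat.pair F.code (Nat.pair G₀.code G₁.code)) =
          Part.some (Nat.pair D₀.code D₁.code) ∧
        AmalgDiagOver K G₀ G₁ D₀ D₁

/-! ### Ultrahomogeneity -/

/-- `M` is ultrahomogeneous: every isomorphism between finitely generated substructures
extends to an automorphism. -/
def Ultrahomogeneous (M : Str L) : Prop :=
  ∀ as bs : List ℕ, TupleIn M as → TupleIn M bs → ClSim M as M bs →
    ∃ g : ℕ → ℕ, IsAutoOf M g ∧ as.map g = bs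

/-- `g` is a bijection of the underlying set of `M` with itself. -/
def BijOnDom (M : Str L) (g : ℕ → ℕ) : Prop :=
  (∀ x ∈ M.dom, g x ∈ M.dom) ∧
  (∀ x ∈ M.dom, ∀ y ∈ M.dom, g x = g y → x = y) ∧
  (∀ y ∈ M.dom, ∃ x ∈ M.dom, g x = y)

/-- `M` is `s`-computably ultrahomogeneous. -/
def CompUltrahom (s : Set ℕ) (M : Str L) : Prop :=
  ∃ c : OCode, ∀ as bs : List ℕ, TupleIn M as → TupleIn M bs →
    as.length = bs.length →
    ∃ e : ℕ,
      OCode.eval (chi s) c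
          (Nat.pair (Encodable.encode as) (Encodable.encode bs)) = Part.some e ∧
      ∃ c' : OCode, c'.encodeCode = e ∧ ∃ g : ℕ → ℕ, ComputesIn s c' g ∧
        BijOnDom M g ∧
        (ClSim M as M bs → IsAutoOf M g ∧ as.map g = bs)

/-! ### Cofinal ultrahomogeneity -/

/-- `M` is cofinally ultrahomogeneous. -/
def CofinallyUltrahomogeneous (M : Str L) : Prop :=
  ∀ as : List ℕ, TupleIn M as → ∃ bs : List ℕ, TupleIn M bs ∧
    (∀ x ∈ as, InClosure M bs x) ∧
    ∀ cs : List ℕ, TupleIn M cs → ClSim M bs M cs →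
      ∃ g : ℕ → ℕ, IsAutoOf M g ∧ bs.map g = cs

/-- `E` is a cofinal collection of tuples in `M`. -/
def IsCofinalCollection (M : Str L) (E : Set (List ℕ)) : Prop :=
  (∀ bs ∈ E, TupleIn M bs) ∧
  (∀ as : List ℕ, TupleIn M as → ∃ bs ∈ E, ∀ x ∈ as, InClosure M bs x) ∧
  (∀ bs ∈ E, ∀ as : List ℕ, (∀ x ∈ as, InClosure M bs x) → (as ++ bs) ∈ E) ∧
  (∀ as ∈ E, ∀ bs : List ℕ, TupleIn M bs → ClSim M as M bs → bs ∈ E)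

/-- `M` is cofinally ultrahomogeneous for the collection `E`: every isomorphism between
substructures generated by members of `E` extends to an automorphism. -/
def CofUltraFor (M : Str L) (E : Set (List ℕ)) : Prop :=
  ∀ as ∈ E, ∀ bs ∈ E, ClSim M as M bs →
    ∃ g : ℕ → ℕ, IsAutoOf M g ∧ as.map g = bs

/-- The set of codes of members of `E`. -/
def ECodes (E : Set (List ℕ)) : Set ℕ := { p | ∃ as ∈ E, p = Encodable.encode as }

/-- The functional part of `s`-computable cofinal ultrahomogeneity with respect to `E`. -/
def CofUltraFunIn (s : Set ℕ) (M : Str L) (E : Set (List ℕ)) : Prop :=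
  ∃ c : OCode, ∀ as ∈ E, ∀ bs : List ℕ, TupleIn M bs → TupleSim as bs →
    ∃ e : ℕ,
      OCode.eval (chi s) c
          (Nat.pair (Encodable.encode as) (Encodable.encode bs)) = Part.some e ∧
      ∃ c' : OCode, c'.encodeCode = e ∧ ∃ g : ℕ → ℕ, ComputesIn s c' g ∧
        BijOnDom M g ∧ as.map g = bs ∧
        (ClSim M as M bs → IsAutoOf M g)

/-- `M` is `s`-computably cofinally ultrahomogeneous with respect to `E`. -/
def CompCofUltrahomWrt (s : Set ℕ) (M : Str L) (E : Set (List ℕ)) : Prop :=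
  IsCofinalCollection M E ∧ SetRecIn s (ECodes E) ∧ CofUltraFunIn s M E

/-- `M` is `s`-computably cofinally ultrahomogeneous. -/
def CompCofUltrahom (s : Set ℕ) (M : Str L) : Prop :=
  ∃ E : Set (List ℕ), CompCofUltrahomWrt s M E

/-- The `s`-computable cofinal extension property with respect to `E`. -/
def CompCofExtProp (s : Set ℕ) (M : Str L) (E : Set (List ℕ)) : Prop :=
  ∃ c : OCode, ∀ as bs cs : List ℕ, as ∈ E → cs ∈ E → TupleIn M bs →
    (∀ x ∈ as, InClosure M cs x) → TupleSim as bs →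
    ∃ ds : List ℕ,
      OCode.eval (chi s) c
          (Nat.pair (Encodable.encode as)
            (Nat.pair (Encodable.encode bs) (Encodable.encode cs))) =
        Part.some (Encodable.encode ds) ∧
      TupleIn M ds ∧ TupleSim (as ++ cs) (bs ++ ds) ∧
      (ClSim M as M bs →
        ClSim M ds M cs ∧ (∀ x ∈ bs, InClosure M ds x) ∧
        ∀ h h' : ℕ → ℕ,
          ds.map h = cs → IsIsoMap (M.sub ds) (M.sub cs) h →
          bs.map h' = as → IsIsoMap (M.sub bs) (M.sub as) h' →
          bs.map h = bs.map h')

/-! ### Canonical ages and limits -/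

/-- `K` is a canonical age of `M` (relative to the oracle `t`): the enumeration of
generating tuples is `t`-computable, lists every finite tuple of `M` infinitely often,
and `str i` is the substructure generated by `tup i`. -/
def IsCanonicalAgeOf (t : Set ℕ) (K : CompAge L) (M : Str L) : Prop :=
  TotalComputableIn t (fun i => Encodable.encode (K.tup i)) ∧
  (∀ i, TupleIn M (K.tup i)) ∧
  (∀ as : List ℕ, TupleIn M as → ∀ n : ℕ, ∃ i, n ≤ i ∧ K.tup i = as) ∧
  (∀ i, K.str i = M.sub (K.tup i))

/-- `K` represents the age of `M`. -/
def RepresentsAgeOf (K : CompAge L) (M : Str L) : Prop :=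
  (∀ i, AgeMemOf M (K.str i)) ∧
  (∀ B : Str L, AgeMemOf M B → ∃ i, Isom B (K.str i))

/-- `M` is a cofinal Fraïssé limit of (the age represented by) `K`. -/
def CofinalFraisseLimitOf (K : CompAge L) (M : Str L) : Prop :=
  CofinallyUltrahomogeneous M ∧ RepresentsAgeOf K M

/-- The enumerated age `K` is uniformly finite. -/
def UniformlyFinite (K : CompAge L) : Prop :=
  L.FiniteLang ∧ ∃ f : ℕ → ℕ, TotalComputableIn ∅ f ∧
    ∀ i, ∀ as : List ℕ, TupleIn (K.str i) as →
      { x | InClosure (K.str i) as x }.Finite ∧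
      { x | InClosure (K.str i) as x }.ncard ≤ f as.length


/-! ### Translation of oracle codes into ordinary codes -/

open Nat.Partrec (Code)

/-- A code for the map `((a, b), c) ↦ (a, (b, c))`. -/
def assocCode : Code :=
  .pair (.comp .left .left) (.pair (.comp .right .left) .right)

/-- A code for the map `(a, (b, c)) ↦ ((a, b), c)`. -/
def unassocCode : Code :=
  .pair (.pair .left (.comp .left .right)) (.comp .right .right)

theorem some_bind_pfun (n : ℕ) (f : ℕ →. ℕ) : (Part.some n >>= f) = f n :=
  Part.bind_some n f

theorem part_bind_pfun (x : Part ℕ) (f : ℕ →. ℕ) : (x >>= f) = x.bind fun a => f a :=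
  rfl

theorem mem_map_rfind {p : ℕ → Part ℕ} {b v : ℕ} :
    v ∈ Part.map (· + b) (Nat.rfind fun n => (fun m => decide (m = 0)) <$> p n) ↔
      ∃ k, 0 ∈ p k ∧ (∀ m < k, ∃ z ∈ p m, z ≠ 0) ∧ k + b = v := by
  rw [Part.mem_map_iff]
  refine exists_congr fun k => ?_
  rw [← and_assoc]
  refine and_congr_left fun _ => (Nat.mem_rfind (p := fun n => _)).trans ?_
  simp [Part.mem_map_iff]

theorem eval_assocCode (a b c : ℕ) :
    assocCode.eval (Nat.pair (Nat.pair a b) c) = Part.some (Nat.pair a (Nat.pair b c)) := by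
  simp [assocCode, Code.eval, Seq.seq, some_bind_pfun]

theorem eval_unassocCode (a b c : ℕ) :
    unassocCode.eval (Nat.pair a (Nat.pair b c)) = Part.some (Nat.pair (Nat.pair a b) c) := by
  simp [unassocCode, Code.eval, Seq.seq, some_bind_pfun]

/-- The ordinary code which on input `(σ, n)` simulates an oracle code on input `n`, answering
an oracle query `x` by running `q` on `(σ, x)`. -/
def OCode.toCode (q : Code) : OCode → Code
  | .zero => .zero
  | .succ => .comp .succ .right
  | .left => .comp .left .right
  | .right => .comp .right .right
  | .oracle => q
  | .pair f g => .pair (f.toCode q) (g.toCode q)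
  | .comp f g => .comp (f.toCode q) (.pair .left (g.toCode q))
  | .prec f g => .comp (.prec (f.toCode q) (.comp (g.toCode q) assocCode)) unassocCode
  | .rfind' f => .comp (.rfind' (.comp (f.toCode q) assocCode)) unassocCode

theorem OCode.eval_toCode (q : Code) (σ : ℕ) (c : OCode) (n : ℕ) :
    (c.toCode q).eval (Nat.pair σ n) = c.eval (fun x => q.eval (Nat.pair σ x)) n := by
  induction c generalizing n with
  | zero => simp [toCode, Code.eval, OCode.eval]; rfl
  | succ => simp [toCode, Code.eval, OCode.eval, some_bind_pfun]
  | left => simp [toCode, Code.eval, OCode.eval, some_bind_pfun]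
  | right => simp [toCode, Code.eval, OCode.eval, some_bind_pfun]
  | oracle => simp [toCode, OCode.eval]
  | pair f g hf hg => simp [toCode, Code.eval, OCode.eval, hf, hg]
  | comp f g hf hg => 
    simp only [toCode, Code.eval, OCode.eval, hg]
    simp [Seq.seq, part_bind_pfun, hf, Part.bind_map]
  | prec f g hf hg =>
    obtain ⟨⟨a, b⟩, rfl⟩ := Nat.pairEquiv.surjective n
    simp only [toCode, Code.eval, OCode.eval, Nat.pairEquiv_apply, Function.uncurry,
      eval_unassocCode, Part.bind_eq_bind, Part.bind_some, Nat.unpaired, Nat.unpair_pair]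
    induction b with
    | zero => simp [hf]
    | succ b ih =>
      simp only [eval_assocCode, some_bind_pfun, hg] at ih ⊢
      rw [ih]
  | rfind' f hf =>
    obtain ⟨⟨a, b⟩, rfl⟩ := Nat.pairEquiv.surjective n
    simp only [toCode, Code.eval, OCode.eval, Nat.pairEquiv_apply, Function.uncurry,
      eval_unassocCode, Part.bind_eq_bind, Part.bind_some, Nat.unpaired, Nat.unpair_pair,
      eval_assocCode, some_bind_pfun, hf]

theorem OCode.eval_mono {O O' : ℕ →. ℕ} (h : ∀ x y, y ∈ O x → y ∈ O' x) (c : OCode) {n v : ℕ}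
    (hv : v ∈ c.eval O n) : v ∈ c.eval O' n := by
  induction c generalizing n v with
  | zero => exact hv
  | succ => exact hv
  | left => exact hv
  | right => exact hv
  | oracle => exact h _ _ hv
  | pair f g hf hg =>
    simp only [OCode.eval, Seq.seq, Part.map_eq_map, Part.bind_map, Part.mem_bind_iff,
      Part.mem_map_iff] at hv ⊢
    obtain ⟨a, ha, b, hb, rfl⟩ := hv
    exact ⟨a, hf ha, b, hg hb, rfl⟩
  | comp f g hf hg =>
    simp only [OCode.eval, part_bind_pfun, Part.mem_bind_iff] at hv ⊢
    obtain ⟨a, ha, hb⟩ := hv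
    exact ⟨a, hg ha, hf hb⟩
  | prec f g hf hg =>
    obtain ⟨⟨a, b⟩, rfl⟩ := Nat.pairEquiv.surjective n
    simp only [OCode.eval, Nat.pairEquiv_apply, Function.uncurry, Nat.unpaired,
      Nat.unpair_pair] at hv ⊢
    induction b generalizing v with
    | zero => exact hf hv
    | succ b ih =>
      simp only [Part.bind_eq_bind, Part.mem_bind_iff] at hv ⊢
      obtain ⟨i, hi, hv⟩ := hv
      exact ⟨i, ih hi, hg hv⟩
  | rfind' f hf =>
    obtain ⟨⟨a, b⟩, rfl⟩ := Nat.pairEquiv.surjective n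
    simp only [OCode.eval, Nat.pairEquiv_apply, Function.uncurry, Nat.unpaired,
      Nat.unpair_pair, mem_map_rfind] at hv ⊢
    obtain ⟨k, hy, hk, rfl⟩ := hv
    refine ⟨k, hf hy, fun m hm => ?_, rfl⟩
    obtain ⟨z, hz, hz'⟩ := hk m hm
    exact ⟨z, hf hz, hz'⟩

theorem exists_forall_lt_of_mono {P : ℕ → ℕ → Prop} (hP : ∀ m l l', l ≤ l' → P m l → P m l')
    (k : ℕ) (h : ∀ m < k, ∃ l, P m l) : ∃ l, ∀ m < k, P m l := by
  induction k with
  | zero => exact ⟨0, by simp⟩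
  | succ k ih =>
    obtain ⟨l, hl⟩ := ih fun m hm => h m (by omega)
    obtain ⟨l', hl'⟩ := h k (by omega)
    refine ⟨max l l', fun m hm => ?_⟩
    rcases Nat.lt_succ_iff_lt_or_eq.1 hm with hm | rfl
    · exact hP _ _ _ (le_max_left _ _) (hl m hm)
    · exact hP _ _ _ (le_max_right _ _) hl'

/-- Evaluation is continuous in the oracle. -/
theorem OCode.exists_mem_eval {O : ℕ →. ℕ} {Os : ℕ → ℕ →. ℕ}
    (hmono : ∀ l l', l ≤ l' → ∀ x y, y ∈ Os l x → y ∈ Os l' x)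
    (hlim : ∀ x y, y ∈ O x → ∃ l, y ∈ Os l x) (c : OCode) {n v : ℕ}
    (hv : v ∈ c.eval O n) : ∃ l, v ∈ c.eval (Os l) n := by
  induction c generalizing n v with
  | zero => exact ⟨0, hv⟩
  | succ => exact ⟨0, hv⟩
  | left => exact ⟨0, hv⟩
  | right => exact ⟨0, hv⟩
  | oracle => exact hlim _ _ hv
  | pair f g hf hg =>
    simp only [OCode.eval, Seq.seq, Part.map_eq_map, Part.bind_map, Part.mem_bind_iff,
      Part.mem_map_iff] at hv ⊢
    obtain ⟨a, ha, b, hb, rfl⟩ := hv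
    obtain ⟨l, hl⟩ := hf ha
    obtain ⟨l', hl'⟩ := hg hb
    exact ⟨max l l', a, eval_mono (hmono _ _ (le_max_left _ _)) _ hl, b,
      eval_mono (hmono _ _ (le_max_right _ _)) _ hl', rfl⟩
  | comp f g hf hg =>
    simp only [OCode.eval, part_bind_pfun, Part.mem_bind_iff] at hv ⊢
    obtain ⟨a, ha, hb⟩ := hv
    obtain ⟨l, hl⟩ := hg ha
    obtain ⟨l', hl'⟩ := hf hb
    exact ⟨max l l', a, eval_mono (hmono _ _ (le_max_left _ _)) _ hl,
      eval_mono (hmono _ _ (le_max_right _ _)) _ hl'⟩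
  | prec f g hf hg =>
    obtain ⟨⟨a, b⟩, rfl⟩ := Nat.pairEquiv.surjective n
    simp only [Nat.pairEquiv_apply, Function.uncurry] at hv ⊢
    induction b generalizing v with
    | zero =>
      simp only [OCode.eval, Nat.unpaired, Nat.unpair_pair] at hv ⊢
      exact hf hv
    | succ b ih =>
      have key : ∀ O' : ℕ →. ℕ, v ∈ (OCode.prec f g).eval O' (Nat.pair a (b + 1)) ↔
          ∃ i ∈ (OCode.prec f g).eval O' (Nat.pair a b),
            v ∈ g.eval O' (Nat.pair a (Nat.pair b i)) := by
        intro O'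
        simp only [OCode.eval, Nat.unpaired, Nat.unpair_pair, Part.bind_eq_bind,
          Part.mem_bind_iff]
      simp only [key] at hv ⊢
      obtain ⟨i, hi, hv⟩ := hv
      obtain ⟨l, hl⟩ := ih hi
      obtain ⟨l', hl'⟩ := hg hv
      exact ⟨max l l', i, eval_mono (hmono _ _ (le_max_left _ _)) _ hl,
        eval_mono (hmono _ _ (le_max_right _ _)) _ hl'⟩
  | rfind' f hf =>
    obtain ⟨⟨a, b⟩, rfl⟩ := Nat.pairEquiv.surjective n
    simp only [OCode.eval, Nat.pairEquiv_apply, Function.uncurry, Nat.unpaired,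
      Nat.unpair_pair, mem_map_rfind] at hv ⊢
    obtain ⟨k, hy, hk, rfl⟩ := hv
    obtain ⟨l, hl⟩ := hf hy
    obtain ⟨l', hl'⟩ := exists_forall_lt_of_mono
      (P := fun m l => ∃ z ∈ f.eval (Os l) (Nat.pair a (m + b)), z ≠ 0)
      (fun m l l' hle ⟨z, hz, hz'⟩ => ⟨z, eval_mono (hmono _ _ hle) _ hz, hz'⟩) k
      (fun m hm => by
        obtain ⟨z, hz, hz'⟩ := hk m hm
        obtain ⟨l, hl⟩ := hf hz
        exact ⟨l, z, hl, hz'⟩)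
    refine ⟨max l l', k, eval_mono (hmono _ _ (le_max_left _ _)) _ hl, fun m hm => ?_, rfl⟩
    obtain ⟨z, hz, hz'⟩ := hl' m hm
    exact ⟨z, eval_mono (hmono _ _ (le_max_right _ _)) _ hz, hz'⟩

/-! ### Finite oracle approximations and the jump -/

/-- Look up an entry of a coded list of naturals. -/
def lookup : ℕ →. ℕ :=
  fun p => Part.ofOption ((Denumerable.ofNat (List ℕ) p.unpair.1)[p.unpair.2]?)

theorem partrec_lookup : Nat.Partrec lookup := by
  refine Partrec.nat_iff.1 (Computable.ofOption ?_)
  exact (Primrec.list_getElem?.comp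
    ((Primrec.ofNat (List ℕ)).comp (Primrec.fst.comp Primrec.unpair))
    (Primrec.snd.comp Primrec.unpair)).to_comp

/-- A code for `lookup`. -/
noncomputable def lookupCode : Code := (Code.exists_code.1 partrec_lookup).choose

theorem eval_lookupCode : lookupCode.eval = lookup :=
  (Code.exists_code.1 partrec_lookup).choose_spec

/-- The code of the list of the first `l` values of `O`. -/
def pfx (O : ℕ → ℕ) (l : ℕ) : ℕ := Encodable.encode ((List.range l).map O)

theorem mem_lookup_pfx {O : ℕ → ℕ} {l x y : ℕ} :
    y ∈ lookup (Nat.pair (pfx O l) x) ↔ x < l ∧ O x = y := by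
  simp only [lookup, pfx, Nat.unpair_pair, Denumerable.ofNat_encode, Part.mem_ofOption,
    List.getElem?_map, Option.mem_def]
  by_cases h : x < l
  · simp [h]
  · simp [h]

theorem pfx_congr {O O' : ℕ → ℕ} {l : ℕ} (h : ∀ x < l, O x = O' x) : pfx O l = pfx O' l := by
  unfold pfx
  congr 1
  exact List.map_congr_left fun x hx => h x (List.mem_range.1 hx)

theorem exists_mem_eval_pfx {O : ℕ → ℕ} {c : OCode} {n v : ℕ} :
    v ∈ c.eval (fun x => Part.some (O x)) n ↔
      ∃ l, v ∈ (c.toCode lookupCode).eval (Nat.pair (pfx O l) n) := by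
  simp only [OCode.eval_toCode, eval_lookupCode]
  constructor
  · intro h
    refine OCode.exists_mem_eval (Os := fun l x => lookup (Nat.pair (pfx O l) x)) ?_ ?_ c h
    · intro l l' hl x y hy
      rw [mem_lookup_pfx] at hy ⊢
      exact ⟨hy.1.trans_le hl, hy.2⟩
    · intro x y hy
      exact ⟨x + 1, mem_lookup_pfx.2 ⟨Nat.lt_succ_self x, (Part.mem_some_iff.1 hy).symm⟩⟩
  · rintro ⟨l, h⟩
    refine OCode.eval_mono (fun x y hy => ?_) c h
    rw [mem_lookup_pfx] at hy
    exact Part.mem_some_iff.2 hy.2.symm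

/-- One step of the recursion defining `codeAt`: the `l.length`-th value from the earlier ones. -/
noncomputable def codeStep (l : List Code) : Code :=
  if l.length = 0 then OCode.zero.toCode lookupCode
  else if l.length = 1 then OCode.succ.toCode lookupCode
  else if l.length = 2 then OCode.left.toCode lookupCode
  else if l.length = 3 then OCode.right.toCode lookupCode
  else if l.length = 4 then OCode.oracle.toCode lookupCode
  else
    if (l.length - 5) % 4 = 0 then
      .pair (l.getD ((l.length - 5) / 4).unpair.1 .zero)
        (l.getD ((l.length - 5) / 4).unpair.2 .zero)
    else if (l.length - 5) % 4 = 1 then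
      .comp (l.getD ((l.length - 5) / 4).unpair.1 .zero)
        (.pair .left (l.getD ((l.length - 5) / 4).unpair.2 .zero))
    else if (l.length - 5) % 4 = 2 then
      .comp (.prec (l.getD ((l.length - 5) / 4).unpair.1 .zero)
        (.comp (l.getD ((l.length - 5) / 4).unpair.2 .zero) assocCode)) unassocCode
    else .comp (.rfind' (.comp (l.getD ((l.length - 5) / 4) .zero) assocCode)) unassocCode

theorem primrec_codeStep : Primrec codeStep := by
  have hlen : Primrec fun l : List Code => l.length := Primrec.list_length
  have hn : Primrec fun l : List Code => l.length - 5 :=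
    Primrec.nat_sub.comp hlen (Primrec.const 5)
  have hm : Primrec fun l : List Code => (l.length - 5) / 4 :=
    Primrec.nat_div.comp hn (Primrec.const 4)
  have hr : Primrec fun l : List Code => (l.length - 5) % 4 :=
    Primrec.nat_mod.comp hn (Primrec.const 4)
  have hget : ∀ {f : List Code → ℕ}, Primrec f → Primrec fun l : List Code => l.getD (f l) Code.zero :=
    fun hf => (Primrec.list_getD Code.zero).comp Primrec.id hf
  have ha := hget (Primrec.fst.comp (Primrec.unpair.comp hm))
  have hb := hget (Primrec.snd.comp (Primrec.unpair.comp hm))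
  have hc := hget hm
  have heq : ∀ {f : List Code → ℕ} (k : ℕ), Primrec f → PrimrecPred fun l => f l = k :=
    fun k hf => Primrec.eq.comp hf (Primrec.const k)
  refine .ite (heq 0 hlen) (.const _) (.ite (heq 1 hlen) (.const _) (.ite (heq 2 hlen) (.const _)
    (.ite (heq 3 hlen) (.const _) (.ite (heq 4 hlen) (.const _) (.ite (heq 0 hr) ?_
      (.ite (heq 1 hr) ?_ (.ite (heq 2 hr) ?_ ?_)))))))
  · exact Code.primrec₂_pair.comp ha hb
  · exact Code.primrec₂_comp.comp ha (Code.primrec₂_pair.comp (.const _) hb)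
  · exact Code.primrec₂_comp.comp (Code.primrec₂_prec.comp ha
      (Code.primrec₂_comp.comp hb (.const _))) (.const _)
  · exact Code.primrec₂_comp.comp (Code.primrec_rfind'.comp
      (Code.primrec₂_comp.comp hc (.const _))) (.const _)

/-- The list of the first `n` values of `codeAt`. -/
noncomputable def codeList : ℕ → List Code
  | 0 => []
  | n + 1 => codeList n ++ [codeStep (codeList n)]

/-- The translation of the oracle code with number `e`. -/
noncomputable def codeAt (e : ℕ) : Code := codeStep (codeList e)

theorem primrec_codeAt : Primrec codeAt := by
  refine primrec_codeStep.comp ?_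
  refine (Primrec.nat_rec' (f := fun n : ℕ => n) (g := fun _ => ([] : List Code))
    (h := fun _ p => p.2 ++ [codeStep p.2]) .id (.const _) ?_).of_eq fun n => ?_
  · exact (Primrec.list_concat.comp (Primrec.snd.comp Primrec.snd)
      (primrec_codeStep.comp (Primrec.snd.comp Primrec.snd))).to₂
  · induction n with
    | zero => rfl
    | succ n ih => simp only [codeList, ← ih]

theorem codeList_eq (n : ℕ) : codeList n = (List.range n).map codeAt := by
  induction n with
  | zero => rfl
  | succ n ih => rw [codeList, List.range_succ, List.map_append, ← ih]; rfl

theorem length_codeList (n : ℕ) : (codeList n).length = n := by simp [codeList_eq]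

theorem getD_codeList {n m : ℕ} (h : m < n) : (codeList n).getD m .zero = codeAt m := by
  simp [codeList_eq, List.getD, List.getElem?_range h]

theorem codeAt_encodeCode (c : OCode) : codeAt c.encodeCode = c.toCode lookupCode := by
  induction c with
  | zero => simp [codeAt, codeStep, length_codeList, OCode.encodeCode]
  | succ => simp [codeAt, codeStep, length_codeList, OCode.encodeCode]
  | left => simp [codeAt, codeStep, length_codeList, OCode.encodeCode]
  | right => simp [codeAt, codeStep, length_codeList, OCode.encodeCode]
  | oracle => simp [codeAt, codeStep, length_codeList, OCode.encodeCode]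
  | pair f g hf hg =>
    have h1 := Nat.left_le_pair f.encodeCode g.encodeCode
    have h2 := Nat.right_le_pair f.encodeCode g.encodeCode
    rw [OCode.encodeCode]
    generalize hp : Nat.pair f.encodeCode g.encodeCode = p at *
    have e1 : (4 * p + 5 - 5) % 4 = 0 := by omega
    have e2 : (4 * p + 5 - 5) / 4 = p := by omega
    rw [codeAt, codeStep]
    simp only [length_codeList, e1, e2]
    rw [getD_codeList (by rw [← hp, Nat.unpair_pair]; dsimp only; omega),
      getD_codeList (by rw [← hp, Nat.unpair_pair]; dsimp only; omega)]
    simp [← hp, hf, hg, OCode.toCode]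
  | comp f g hf hg =>
    have h1 := Nat.left_le_pair f.encodeCode g.encodeCode
    have h2 := Nat.right_le_pair f.encodeCode g.encodeCode
    rw [OCode.encodeCode]
    generalize hp : Nat.pair f.encodeCode g.encodeCode = p at *
    have e1 : (4 * p + 6 - 5) % 4 = 1 := by omega
    have e2 : (4 * p + 6 - 5) / 4 = p := by omega
    rw [codeAt, codeStep]
    simp only [length_codeList, e1, e2]
    rw [getD_codeList (by rw [← hp, Nat.unpair_pair]; dsimp only; omega),
      getD_codeList (by rw [← hp, Nat.unpair_pair]; dsimp only; omega)]
    simp [← hp, hf, hg, OCode.toCode]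
  | prec f g hf hg =>
    have h1 := Nat.left_le_pair f.encodeCode g.encodeCode
    have h2 := Nat.right_le_pair f.encodeCode g.encodeCode
    rw [OCode.encodeCode]
    generalize hp : Nat.pair f.encodeCode g.encodeCode = p at *
    have e1 : (4 * p + 7 - 5) % 4 = 2 := by omega
    have e2 : (4 * p + 7 - 5) / 4 = p := by omega
    rw [codeAt, codeStep]
    simp only [length_codeList, e1, e2]
    rw [getD_codeList (by rw [← hp, Nat.unpair_pair]; dsimp only; omega),
      getD_codeList (by rw [← hp, Nat.unpair_pair]; dsimp only; omega)]
    simp [← hp, hf, hg, OCode.toCode]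
  | rfind' f hf =>
    rw [OCode.encodeCode]
    have e1 : (4 * f.encodeCode + 8 - 5) % 4 = 3 := by omega
    have e2 : (4 * f.encodeCode + 8 - 5) / 4 = f.encodeCode := by omega
    rw [codeAt, codeStep]
    simp only [length_codeList, e1, e2]
    rw [getD_codeList (m := f.encodeCode) (by omega)]
    simp [hf, OCode.toCode]

theorem OCode.encodeCode_surjective : Function.Surjective OCode.encodeCode := by
  intro e
  induction e using Nat.strong_induction_on with
  | _ e ih =>
    match e, ih with
    | 0, _ => exact ⟨.zero, rfl⟩
    | 1, _ => exact ⟨.succ, rfl⟩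
    | 2, _ => exact ⟨.left, rfl⟩
    | 3, _ => exact ⟨.right, rfl⟩
    | 4, _ => exact ⟨.oracle, rfl⟩
    | n + 5, ih =>
      have h1 := Nat.unpair_left_le (n / 4)
      have h2 := Nat.unpair_right_le (n / 4)
      obtain ⟨f, hf⟩ := ih (n / 4).unpair.1 (by omega)
      obtain ⟨g, hg⟩ := ih (n / 4).unpair.2 (by omega)
      obtain ⟨r, hr⟩ := ih (n / 4) (by omega)
      have : n % 4 = 0 ∨ n % 4 = 1 ∨ n % 4 = 2 ∨ n % 4 = 3 := by omega
      rcases this with h | h | h | h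
      · exact ⟨.pair f g, by simp only [encodeCode, hf, hg, Nat.pair_unpair]; omega⟩
      · exact ⟨.comp f g, by simp only [encodeCode, hf, hg, Nat.pair_unpair]; omega⟩
      · exact ⟨.prec f g, by simp only [encodeCode, hf, hg, Nat.pair_unpair]; omega⟩
      · exact ⟨.rfind' r, by simp only [encodeCode, hr]; omega⟩

/-- Whether the computation `x` (a pair of an oracle code number and an input) halts within the
resources `j` (a bound on the oracle queries and a number of steps). -/
noncomputable def haltsBy (O : ℕ → ℕ) (j x : ℕ) : Bool :=
  (Code.evaln j.unpair.2 (codeAt x.unpair.1)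
    (Nat.pair (pfx O j.unpair.1) x.unpair.2)).isSome

/-- The characteristic function of a set. -/
noncomputable def bit (A : Set ℕ) (n : ℕ) : ℕ := if n ∈ A then 1 else 0

theorem haltsBy_congr {O O' : ℕ → ℕ} {j x : ℕ} (h : ∀ y < j, O y = O' y) :
    haltsBy O j x = haltsBy O' j x := by
  unfold haltsBy
  rw [pfx_congr fun y hy => h y (hy.trans_le (Nat.unpair_left_le j))]

theorem dom_eval_iff_haltsBy {A : Set ℕ} {c : OCode} {n : ℕ} :
    (c.eval (chi A) n).Dom ↔ ∃ j, haltsBy (bit A) j (Nat.pair c.encodeCode n) = true := by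
  simp only [haltsBy, Nat.unpair_pair, codeAt_encodeCode, Option.isSome_iff_exists]
  rw [Part.dom_iff_mem]
  constructor
  · rintro ⟨v, hv⟩
    obtain ⟨l, hl⟩ := exists_mem_eval_pfx.1 hv
    obtain ⟨k, hk⟩ := Code.evaln_complete.1 hl
    exact ⟨Nat.pair l k, v, by simpa only [Nat.unpair_pair] using! hk⟩
  · rintro ⟨j, v, hv⟩
    exact ⟨v, exists_mem_eval_pfx.2 ⟨_, Code.evaln_sound hv⟩⟩

theorem mem_jump_iff {A : Set ℕ} {x : ℕ} : x ∈ jump A ↔ ∃ j, haltsBy (bit A) j x = true := by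
  constructor
  · rintro ⟨c, hc, h⟩
    obtain ⟨j, hj⟩ := dom_eval_iff_haltsBy.1 h
    exact ⟨j, by rwa [hc, Nat.pair_unpair] at hj⟩
  · rintro ⟨j, hj⟩
    obtain ⟨c, hc⟩ := OCode.encodeCode_surjective x.unpair.1
    refine ⟨c, hc, dom_eval_iff_haltsBy.2 ⟨j, ?_⟩⟩
    rwa [hc, Nat.pair_unpair]

theorem primrec_haltsBy {α : Type*} [Primcodable α] {O : α → ℕ → ℕ} {f g : α → ℕ}
    (hO : Primrec₂ O) (hf : Primrec f) (hg : Primrec g) :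
    Primrec fun a => haltsBy (O a) (f a) (g a) := by
  refine Primrec.option_isSome.comp (Code.primrec_evaln.comp (.pair (.pair ?_ ?_) ?_))
  · exact Primrec.snd.comp (Primrec.unpair.comp hf)
  · exact primrec_codeAt.comp (Primrec.fst.comp (Primrec.unpair.comp hg))
  · refine Primrec₂.natPair.comp (Primrec.encode.comp (Primrec.list_map
      (Primrec.list_range.comp (Primrec.fst.comp (Primrec.unpair.comp hf))) hO))
      (Primrec.snd.comp (Primrec.unpair.comp hg))

/-! ### Closure properties of relative computability -/

theorem exists_oCode_of_partrec {f : ℕ →. ℕ} (hf : Nat.Partrec f) (O : ℕ →. ℕ) :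
    ∃ c : OCode, c.eval O = f := by
  obtain ⟨c, rfl⟩ := Code.exists_code.1 hf
  clear hf
  induction c with
  | zero => exact ⟨.zero, rfl⟩
  | succ => exact ⟨.succ, rfl⟩
  | left => exact ⟨.left, rfl⟩
  | right => exact ⟨.right, rfl⟩
  | pair f g hf hg =>
    obtain ⟨a, ha⟩ := hf
    obtain ⟨b, hb⟩ := hg
    exact ⟨.pair a b, by simp only [OCode.eval, Code.eval, ha, hb]; rfl⟩
  | comp f g hf hg =>
    obtain ⟨a, ha⟩ := hf
    obtain ⟨b, hb⟩ := hg
    exact ⟨.comp a b, by simp only [OCode.eval, Code.eval, ha, hb]; rfl⟩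
  | prec f g hf hg =>
    obtain ⟨a, ha⟩ := hf
    obtain ⟨b, hb⟩ := hg
    exact ⟨.prec a b, by simp only [OCode.eval, Code.eval, ha, hb]; rfl⟩
  | rfind' f hf =>
    obtain ⟨a, ha⟩ := hf
    exact ⟨.rfind' a, by simp only [OCode.eval, Code.eval, ha]; rfl⟩

theorem TotalComputableIn.of_computable {f : ℕ → ℕ} (hf : Computable f) (s : Set ℕ) :
    TotalComputableIn s f := by
  obtain ⟨c, hc⟩ := exists_oCode_of_partrec (Partrec.nat_iff.1 hf) (chi s)
  exact ⟨c, fun n => by rw [hc]; rfl⟩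

theorem TotalComputableIn.of_primrec {f : ℕ → ℕ} (hf : Primrec f) (s : Set ℕ) :
    TotalComputableIn s f :=
  .of_computable hf.to_comp s

theorem TotalComputableIn.comp {s : Set ℕ} {f g : ℕ → ℕ} (hf : TotalComputableIn s f)
    (hg : TotalComputableIn s g) : TotalComputableIn s fun n => f (g n) := by
  obtain ⟨c, hc⟩ := hf
  obtain ⟨d, hd⟩ := hg
  exact ⟨.comp c d, fun n => by simp only [OCode.eval, hd n, some_bind_pfun, hc (g n)]⟩

theorem TotalComputableIn.pair {s : Set ℕ} {f g : ℕ → ℕ} (hf : TotalComputableIn s f)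
    (hg : TotalComputableIn s g) : TotalComputableIn s fun n => Nat.pair (f n) (g n) := by
  obtain ⟨c, hc⟩ := hf
  obtain ⟨d, hd⟩ := hg
  exact ⟨.pair c d, fun n => by simp [OCode.eval, hc n, hd n, Seq.seq]⟩

theorem TotalComputableIn.natRec {s : Set ℕ} {g : ℕ → ℕ} (hg : TotalComputableIn s g) (a : ℕ) :
    TotalComputableIn s fun n => Nat.rec a (fun y i => g (Nat.pair y i)) n := by
  obtain ⟨c, hc⟩ := hg
  obtain ⟨z, hz⟩ := TotalComputableIn.of_primrec (Primrec.const a) s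
  obtain ⟨p, hp⟩ := TotalComputableIn.of_primrec
    (Primrec₂.natPair.comp (Primrec.const 0) Primrec.id) s
  refine ⟨.comp (.prec z (.comp c .right)) p, fun n => ?_⟩
  simp only [OCode.eval, hp n, Part.bind_eq_bind, Part.bind_some, Nat.unpaired, Nat.unpair_pair, id]
  induction n with
  | zero => exact hz 0
  | succ n ih =>
    simp only [ih, Part.bind_some]
    simp only [PFun.coe_val, Nat.unpair_pair]
    rw [some_bind_pfun, hc]

theorem TotalComputableIn.pfx {s : Set ℕ} {O : ℕ → ℕ} (hO : TotalComputableIn s O) :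
    TotalComputableIn s (pfx O) := by
  have happ : Primrec fun p : ℕ =>
      Encodable.encode (Denumerable.ofNat (List ℕ) p.unpair.1 ++ [p.unpair.2]) :=
    Primrec.encode.comp (Primrec.list_concat.comp
      ((Primrec.ofNat (List ℕ)).comp (Primrec.fst.comp Primrec.unpair))
      (Primrec.snd.comp Primrec.unpair))
  have hl : TotalComputableIn s fun p => p.unpair.1 :=
    .of_primrec (Primrec.fst.comp Primrec.unpair) s
  have hr : TotalComputableIn s fun p => p.unpair.2 :=
    .of_primrec (Primrec.snd.comp Primrec.unpair) s
  have := TotalComputableIn.natRec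
    ((TotalComputableIn.of_primrec happ s).comp (hr.pair (hO.comp hl)))
    (Encodable.encode ([] : List ℕ))
  convert this using 1
  funext n
  induction n with
  | zero => rfl
  | succ n ih =>
    simp only
    rw [← ih]
    simp [CFL.pfx, List.range_succ]

/-- Unbounded search relative to an oracle. -/
theorem TotalComputableIn.exists_search {s : Set ℕ} {p : ℕ → ℕ → Bool}
    (hp : TotalComputableIn s fun n => (p n.unpair.1 n.unpair.2).toNat)
    (h : ∀ a, ∃ y, p a y = true) : ∃ f, TotalComputableIn s f ∧ ∀ a, p a (f a) = true := by
  have hneg : Primrec fun n : ℕ => 1 - n := Primrec.nat_sub.comp (.const 1) .id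
  obtain ⟨c, hc⟩ := (TotalComputableIn.of_primrec hneg s).comp hp
  obtain ⟨z, hz⟩ := TotalComputableIn.of_primrec
    (Primrec₂.natPair.comp Primrec.id (Primrec.const 0)) s
  refine ⟨fun a => Nat.find (h a), ⟨.comp (.rfind' c) z, fun a => ?_⟩, fun a => Nat.find_spec (h a)⟩
  simp only [OCode.eval, hz a, Part.bind_eq_bind, Part.bind_some, Nat.unpaired, Nat.unpair_pair, id]
  rw [Part.eq_some_iff, mem_map_rfind]
  refine ⟨Nat.find (h a), ?_, fun m hm => ⟨1, ?_, one_ne_zero⟩, rfl⟩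
  · rw [hc]
    simp [Nat.find_spec (h a)]
  · rw [hc]
    simp [Nat.find_min (h a) hm]

theorem setRecIn_iff {s A : Set ℕ} : SetRecIn s A ↔ TotalComputableIn s (bit A) :=
  exists_congr fun _ => funext_iff

theorem SetRecIn.of_primrec {A : Set ℕ} {p : ℕ → Bool} (hp : Primrec p)
    (h : ∀ n, n ∈ A ↔ p n = true) (s : Set ℕ) : SetRecIn s A := by
  rw [setRecIn_iff]
  refine TotalComputableIn.of_primrec ((Primrec.cond hp (.const 1) (.const 0)).of_eq fun n => ?_) s
  by_cases hn : n ∈ A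
  · simp [bit, hn, (h n).1 hn]
  · simp [bit, hn, Bool.eq_false_iff.2 (mt (h n).2 hn)]

theorem CEIn.of_primrec {A : Set ℕ} {p : ℕ → Bool} (hp : Primrec p)
    (h : ∀ n, n ∈ A ↔ p n = true) (s : Set ℕ) : CEIn s A := by
  have : Partrec fun n => (Part.ofOption (bif p n then some 0 else none) : Part ℕ) :=
    Computable.ofOption (Primrec.cond hp (.const _) (.const _)).to_comp
  obtain ⟨c, hc⟩ := exists_oCode_of_partrec (Partrec.nat_iff.1 this) (chi s)
  refine ⟨c, fun n => ?_⟩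
  rw [hc, h n]
  rcases hpn : p n with _ | _ <;> simp [hpn]

/-! ### Embeddings between members of an age -/

theorem IsEmbMap.comp {A B C : Str L} {f g : ℕ → ℕ} (hf : IsEmbMap A B f) (hg : IsEmbMap B C g) :
    IsEmbMap A C fun x => g (f x) := by
  obtain ⟨hf₁, hf₂, hf₃, hf₄⟩ := hf
  obtain ⟨hg₁, hg₂, hg₃, hg₄⟩ := hg
  have hT : ∀ as, TupleIn A as → TupleIn B (as.map f) := by
    intro as ha y hy
    obtain ⟨x, hx, rfl⟩ := List.mem_map.1 hy
    exact hf₁ x (ha x hx)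
  refine ⟨fun x hx => hg₁ _ (hf₁ x hx),
    fun x hx y hy h => hf₂ x hx y hy (hg₂ _ (hf₁ x hx) _ (hf₁ y hy) h), fun r as ha => ?_,
    fun k as hk ha => ?_⟩
  · rw [hf₃ r as ha, hg₃ r _ (hT as ha), List.map_map]
    rfl
  · have h := hg₄ k (as.map f) (by simpa using hk) (hT as ha)
    rw [← hf₄ k as hk ha, List.map_map] at h
    exact h

theorem IsIsoMap.refl (A : Str L) : IsIsoMap A A id :=
  ⟨⟨fun _ hx => hx, fun _ _ _ _ h => h, fun r as _ => by rw [List.map_id],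
    fun f as _ _ => by rw [List.map_id]; rfl⟩, fun y hy => ⟨y, hy, rfl⟩⟩

/-! ### A relational gadget -/

/-- One binary relation symbol, coded by `0`, and infinitely many unary ones. -/
def gadgetLang : Lang where
  relArity r := some (if r = 0 then 2 else 1)
  funArity _ := none

/-- The element `Nat.pair e (2 * n + 1)` sees everything, `Nat.pair e (2 * n + 2)` sees the
counterexamples to `∀ m, R e n m`, and `Nat.pair e 0` sees nothing. -/
def sees (R : ℕ → ℕ → ℕ → Bool) (x m : ℕ) : Bool :=
  x.unpair.2 % 2 == 1 || !(x.unpair.2 == 0) && !(R x.unpair.1 (x.unpair.2 / 2 - 1) m)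

/-- The unary predicate with code `k`. -/
def mark (R : ℕ → ℕ → ℕ → Bool) (k x : ℕ) : Bool :=
  bif k.unpair.1 == 0 then x.unpair.1 == k.unpair.2
  else x == k.unpair.1 - 1 && sees R x k.unpair.2

/-- The binary relation, relating `Nat.pair e (2 * n + 1)` to `Nat.pair e (2 * n + 2)`. -/
def link (x y : ℕ) : Bool :=
  x.unpair.2 % 2 == 1 && y == Nat.pair x.unpair.1 (x.unpair.2 + 1)

/-- The interpretation of the relation symbols. -/
def gadgetRel (R : ℕ → ℕ → ℕ → Bool) (r : ℕ) (as : List ℕ) : Bool :=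
  bif r == 0 then as.length == 2 && link (as.getD 0 0) (as.getD 1 0)
  else as.length == 1 && mark R (r - 1) (as.getD 0 0)

theorem gadgetRel_zero {R : ℕ → ℕ → ℕ → Bool} (x y : ℕ) :
    gadgetRel R 0 [x, y] = link x y := by
  simp [gadgetRel]

theorem gadgetRel_succ {R : ℕ → ℕ → ℕ → Bool} (k x : ℕ) :
    gadgetRel R (k + 1) [x] = mark R k x := by
  simp [gadgetRel]

theorem length_of_gadgetRel {R : ℕ → ℕ → ℕ → Bool} {r : ℕ} {as : List ℕ}
    (h : gadgetRel R r as = true) : as.length = if r = 0 then 2 else 1 := by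
  by_cases hr : r = 0 <;> simp_all [gadgetRel]

/-- The structure on `ℕ` with the relations `gadgetRel R`. -/
def gadget (R : ℕ → ℕ → ℕ → Bool) : Str gadgetLang where
  dom := Set.univ
  rel r as := gadgetRel R r as = true
  fn _ _ := 0
  rel_valid r as h := ⟨congrArg some (length_of_gadgetRel h).symm, fun _ _ => trivial⟩
  fn_mem _ _ h _ := by simp [gadgetLang] at h

/-- An element distinguished from all others by a unary predicate. -/
def Named (R : ℕ → ℕ → ℕ → Bool) (x : ℕ) : Prop := ∃ m, sees R x m = true

/-- There is at most one `N` with `∀ m, R e N m`. -/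
def AtMostOne (R : ℕ → ℕ → ℕ → Bool) : Prop :=
  ∀ e N N', (∀ m, R e N m = true) → (∀ m, R e N' m = true) → N = N'

theorem not_named_iff {R : ℕ → ℕ → ℕ → Bool} {x : ℕ} :
    ¬ Named R x ↔ x = Nat.pair x.unpair.1 0 ∨
      ∃ N, (∀ m, R x.unpair.1 N m = true) ∧ x = Nat.pair x.unpair.1 (2 * N + 2) := by
  obtain ⟨e, z, rfl⟩ : ∃ e z, x = Nat.pair e z := ⟨_, _, (Nat.pair_unpair x).symm⟩
  simp only [Named, sees, Nat.unpair_pair, Nat.pair_eq_pair, true_and, not_exists]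
  constructor
  · intro h
    rcases Nat.eq_zero_or_pos z with rfl | hz
    · exact .inl rfl
    · have hz2 : z % 2 = 0 := by
        by_contra hc
        have : z % 2 = 1 := by omega
        exact h 0 (by simp [this])
      refine .inr ⟨z / 2 - 1, fun m => ?_, by omega⟩
      have := h m
      simp only [hz2] at this
      simp at this
      exact this (by omega)
  · rintro (rfl | ⟨N, hN, rfl⟩) m
    · simp
    · have h1 : (2 * N + 2) % 2 = 0 := by omega
      simp [h1, hN m]

theorem named_odd {R : ℕ → ℕ → ℕ → Bool} (e n : ℕ) : Named R (Nat.pair e (2 * n + 1)) :=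
  ⟨0, by simp [sees, Nat.add_mod]⟩

theorem mark_eq_iff {R : ℕ → ℕ → ℕ → Bool} {x y : ℕ} :
    (∀ k, mark R k x = mark R k y) ↔
      x.unpair.1 = y.unpair.1 ∧ (x = y ∨ ¬ Named R x ∧ ¬ Named R y) := by
  constructor
  · intro h
    refine ⟨?_, ?_⟩
    · have := h (Nat.pair 0 y.unpair.1)
      simpa [mark] using this
    · by_contra! hc
      obtain ⟨hxy, hc⟩ := hc
      by_cases hx : Named R x
      · obtain ⟨m, hm⟩ := hx
        have := h (Nat.pair (x + 1) m)
        simp [mark, hm] at this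
        exact hxy this.1.symm
      · obtain ⟨m, hm⟩ := hc hx
        have := h (Nat.pair (y + 1) m)
        simp [mark, hm] at this
        exact hxy this.1
  · rintro ⟨h1, rfl | ⟨hx, hy⟩⟩ k
    · rfl
    · have hx' : ∀ m, sees R x m = false := fun m => Bool.eq_false_iff.2 fun h => hx ⟨m, h⟩
      have hy' : ∀ m, sees R y m = false := fun m => Bool.eq_false_iff.2 fun h => hy ⟨m, h⟩
      simp [mark, h1, hx', hy']

theorem inClosure_gadget_iff {A : Str gadgetLang} {s : List ℕ} {x : ℕ} :
    InClosure A s x ↔ x ∈ s ∧ x ∈ A.dom := by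
  constructor
  · rintro (⟨hs, hx⟩ | ⟨f, as, h, _⟩)
    · exact ⟨hs, hx⟩
    · simp [gadgetLang] at h
  · exact fun h => .base h.1 h.2

theorem mem_gadget_sub {R : ℕ → ℕ → ℕ → Bool} {s : List ℕ} {x : ℕ} :
    x ∈ ((gadget R).sub s).dom ↔ x ∈ s :=
  inClosure_gadget_iff.trans (and_iff_left trivial)

theorem isEmbMap_gadget_sub_iff {R : ℕ → ℕ → ℕ → Bool} {as bs : List ℕ} {h : ℕ → ℕ} :
    IsEmbMap ((gadget R).sub as) ((gadget R).sub bs) h ↔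
      (∀ x ∈ as, h x ∈ bs) ∧ (∀ x ∈ as, ∀ y ∈ as, h x = h y → x = y) ∧
      (∀ x ∈ as, ∀ k, mark R k x = mark R k (h x)) ∧
      (∀ x ∈ as, ∀ y ∈ as, link x y = link (h x) (h y)) := by
  simp only [IsEmbMap, mem_gadget_sub, TupleIn]
  refine and_congr_right fun h1 => and_congr_right fun _ => ?_
  have hrel : ∀ r l, (∀ x ∈ l, x ∈ as) → ((((gadget R).sub as).rel r l ↔
      ((gadget R).sub bs).rel r (l.map h)) ↔ gadgetRel R r l = gadgetRel R r (l.map h)) := by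
    intro r l hl
    have e1 : ((gadget R).sub as).rel r l ↔ gadgetRel R r l = true :=
      and_iff_left fun x hx => mem_gadget_sub.2 (hl x hx)
    have e2 : ((gadget R).sub bs).rel r (l.map h) ↔ gadgetRel R r (l.map h) = true := by
      refine and_iff_left fun y hy => mem_gadget_sub.2 ?_
      obtain ⟨x, hx, rfl⟩ := List.mem_map.1 hy
      exact h1 x (hl x hx)
    rw [e1, e2]
    exact Bool.eq_iff_iff.symm
  constructor
  · rintro ⟨h3, -⟩
    refine ⟨fun x hx k => ?_, fun x hx y hy => ?_⟩
    · have := (hrel (k + 1) [x] (by simpa using hx)).1 (h3 _ _ (by simpa using hx))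
      simpa only [List.map_cons, List.map_nil, gadgetRel_succ] using this
    · have := (hrel 0 [x, y] (by simp [hx, hy])).1 (h3 _ _ (by simp [hx, hy]))
      simpa only [List.map_cons, List.map_nil, gadgetRel_zero] using this
  · rintro ⟨h3, h4⟩
    refine ⟨fun r l hl => (hrel r l hl).2 ?_, fun f l hf => by simp [gadgetLang] at hf⟩
    rcases r with _ | k
    · rcases l with _ | ⟨x, _ | ⟨y, _ | ⟨z, l⟩⟩⟩
      · simp [gadgetRel]
      · simp [gadgetRel]
      · simpa only [List.map_cons, List.map_nil, gadgetRel_zero] using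
          h4 x (hl x (by simp)) y (hl y (by simp))
      · simp [gadgetRel]
    · rcases l with _ | ⟨x, _ | ⟨y, l⟩⟩
      · simp [gadgetRel]
      · simpa only [List.map_cons, List.map_nil, gadgetRel_succ] using h3 x (hl x (by simp)) k
      · simp [gadgetRel]

theorem isEmbMap_gadget_of_subset {R : ℕ → ℕ → ℕ → Bool} {as bs : List ℕ} (h : as ⊆ bs) :
    IsEmbMap ((gadget R).sub as) ((gadget R).sub bs) id :=
  isEmbMap_gadget_sub_iff.2 ⟨fun _ hx => h hx, fun _ _ _ _ h => h, fun _ _ _ => rfl,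
    fun _ _ _ _ => rfl⟩

/-- An element whose presence rigidifies the component of `x`. -/
noncomputable def guard (R : ℕ → ℕ → ℕ → Bool) (x : ℕ) : ℕ :=
  if h : ∃ N, ∀ m, R x.unpair.1 N m = true then Nat.pair x.unpair.1 (2 * h.choose + 1) else x

theorem guard_eq {R : ℕ → ℕ → ℕ → Bool} (hR : AtMostOne R) {x N : ℕ}
    (hN : ∀ m, R x.unpair.1 N m = true) : guard R x = Nat.pair x.unpair.1 (2 * N + 1) := by
  have h : ∃ N, ∀ m, R x.unpair.1 N m = true := ⟨N, hN⟩
  rw [guard, dif_pos h, hR _ _ _ h.choose_spec hN]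

theorem guard_guard {R : ℕ → ℕ → ℕ → Bool} (hR : AtMostOne R) (x : ℕ) :
    guard R (guard R x) = guard R x := by
  by_cases h : ∃ N, ∀ m, R x.unpair.1 N m = true
  · obtain ⟨N, hN⟩ := h
    rw [guard_eq hR hN, guard_eq (N := N) hR (by simpa using hN), Nat.unpair_pair]
  · simp [guard, h]

theorem IsEmbMap.apply_eq_of_guard_mem {R : ℕ → ℕ → ℕ → Bool} (hR : AtMostOne R)
    {as bs : List ℕ} {h : ℕ → ℕ} (hh : IsEmbMap ((gadget R).sub as) ((gadget R).sub bs) h)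
    {x : ℕ} (hx : x ∈ as) (hg : guard R x ∈ as) : h x = x := by
  obtain ⟨-, -, h3, h4⟩ := isEmbMap_gadget_sub_iff.1 hh
  obtain ⟨he, hne⟩ := mark_eq_iff.1 (h3 x hx)
  rcases hne with hne | ⟨hnx, hny⟩
  · exact hne.symm
  rw [not_named_iff] at hnx hny
  rw [← he] at hny
  by_cases hT : ∃ N, ∀ m, R x.unpair.1 N m = true
  · obtain ⟨N, hN⟩ := hT
    rw [guard_eq hR hN] at hg
    have hc : h (Nat.pair x.unpair.1 (2 * N + 1)) = Nat.pair x.unpair.1 (2 * N + 1) := by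
      rcases (mark_eq_iff.1 (h3 _ hg)).2 with h' | h'
      · exact h'.symm
      · exact absurd (named_odd _ _) h'.1
    have hl := h4 _ hg x hx
    rw [hc] at hl
    have key : ∀ {w}, w = Nat.pair x.unpair.1 0 ∨ (∃ N, (∀ m, R x.unpair.1 N m = true) ∧
        w = Nat.pair x.unpair.1 (2 * N + 2)) → w = if link (Nat.pair x.unpair.1 (2 * N + 1)) w
          then Nat.pair x.unpair.1 (2 * N + 2) else Nat.pair x.unpair.1 0 := by
      rintro w (hw | ⟨N', hN', hw⟩)
      · have : link (Nat.pair x.unpair.1 (2 * N + 1)) w = false := by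
          rw [hw]; simp [link]
        rw [this]; simpa using hw
      · obtain rfl := hR _ _ _ hN hN'
        have : link (Nat.pair x.unpair.1 (2 * N + 1)) w = true := by
          rw [hw]; simp [link, Nat.add_mod]
        rw [this]; simpa using hw
    exact (key hny).trans (by rw [← hl]; exact (key hnx).symm)
  · have key : ∀ {w}, w = Nat.pair x.unpair.1 0 ∨ (∃ N, (∀ m, R x.unpair.1 N m = true) ∧
        w = Nat.pair x.unpair.1 (2 * N + 2)) → w = Nat.pair x.unpair.1 0 := by
      rintro w (hw | ⟨N, hN, -⟩)
      · exact hw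
      · exact absurd ⟨N, hN⟩ hT
    exact (key hny).trans (key hnx).symm

/-- The canonical age of the gadget. -/
def gadgetAge (R : ℕ → ℕ → ℕ → Bool) : CompAge gadgetLang where
  tup i := Denumerable.ofNat (List ℕ) i.unpair.1
  str i := (gadget R).sub (Denumerable.ofNat (List ℕ) i.unpair.1)
  tup_mem _ _ hx := mem_gadget_sub.2 hx
  gen _ _ := by rw [inClosure_gadget_iff, mem_gadget_sub, and_self]

theorem mem_gadgetAge_cls {R : ℕ → ℕ → ℕ → Bool} {B : Str gadgetLang} :
    B ∈ (gadgetAge R).cls ↔ ∃ as, Isom B ((gadget R).sub as) :=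
  ⟨fun ⟨_, h⟩ => ⟨_, h⟩, fun ⟨as, h⟩ => ⟨Nat.pair (Encodable.encode as) 0, by
    simpa [gadgetAge] using h⟩⟩

theorem amalgBase_of_guard {R : ℕ → ℕ → ℕ → Bool} (hR : AtMostOne R) {as : List ℕ}
    (ha : ∀ x ∈ as, guard R x ∈ as) : AmalgBase (gadgetAge R).cls ((gadget R).sub as) := by
  refine ⟨mem_gadgetAge_cls.2 ⟨as, _, .refl _⟩, fun B₀ h₀ B₁ h₁ f₀ f₁ hf₀ hf₁ => ?_⟩
  obtain ⟨as₀, φ₀, hφ₀, -⟩ := mem_gadgetAge_cls.1 h₀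
  obtain ⟨as₁, φ₁, hφ₁, -⟩ := mem_gadgetAge_cls.1 h₁
  refine ⟨(gadget R).sub (as₀ ++ as₁), mem_gadgetAge_cls.2 ⟨_, _, .refl _⟩, φ₀, φ₁,
    hφ₀.comp (isEmbMap_gadget_of_subset (List.subset_append_left _ _)),
    hφ₁.comp (isEmbMap_gadget_of_subset (List.subset_append_right _ _)), fun x hx => ?_⟩
  rw [mem_gadget_sub] at hx
  exact ((hf₀.comp hφ₀).apply_eq_of_guard_mem hR hx (ha x hx)).trans
    ((hf₁.comp hφ₁).apply_eq_of_guard_mem hR hx (ha x hx)).symm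

theorem coAP_gadgetAge {R : ℕ → ℕ → ℕ → Bool} (hR : AtMostOne R) : CoAP (gadgetAge R).cls := by
  intro A hA
  obtain ⟨as, φ, hφ, -⟩ := mem_gadgetAge_cls.1 hA
  refine ⟨(gadget R).sub (as ++ as.map (guard R)), amalgBase_of_guard hR fun x hx => ?_, _,
    hφ.comp (isEmbMap_gadget_of_subset (List.subset_append_left _ _))⟩
  rcases List.mem_append.1 hx with hx | hx
  · exact List.mem_append_right _ (List.mem_map_of_mem hx)
  · obtain ⟨y, hy, rfl⟩ := List.mem_map.1 hx
    rw [guard_guard hR]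
    exact List.mem_append_right _ hx

/-- An amalgamation base containing one of the two unnamed elements of a component contains the
element distinguishing them. -/
theorem mem_of_amalgBase {R : ℕ → ℕ → ℕ → Bool} (hR : AtMostOne R) {bs : List ℕ} {e N y : ℕ}
    (hN : ∀ m, R e N m = true) (hb : AmalgBase (gadgetAge R).cls ((gadget R).sub bs))
    (hy : y ∈ bs) (hy' : y = Nat.pair e 0 ∨ y = Nat.pair e (2 * N + 2)) :
    Nat.pair e (2 * N + 1) ∈ bs := by
  by_contra hc
  set a := Nat.pair e 0 with ha
  set b := Nat.pair e (2 * N + 2) with hbdef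
  set c := Nat.pair e (2 * N + 1) with hcdef
  have hab : a ≠ b := by simp [ha, hbdef]
  have hca : c ≠ a := by simp [ha, hcdef]
  have hcb : c ≠ b := by simp [hbdef, hcdef]
  have hna : ¬ Named R a := not_named_iff.2 (by simp [ha])
  have hnb : ¬ Named R b := not_named_iff.2 (.inr ⟨N, by simpa [hbdef] using hN, by simp [hbdef]⟩)
  set τ : Equiv.Perm ℕ := Equiv.swap a b with hτ
  have hτc : τ c = c := Equiv.swap_apply_of_ne_of_ne hca hcb
  have hlink : ∀ u v, u ≠ c → link u v = true → τ u = u ∧ τ v = v := by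
    intro u v hu h
    obtain ⟨i, z, rfl⟩ : ∃ e z, u = Nat.pair e z := ⟨_, _, (Nat.pair_unpair u).symm⟩
    simp only [link, Nat.unpair_pair, Bool.and_eq_true, beq_iff_eq] at h
    obtain ⟨hz, rfl⟩ := h
    simp only [hcdef, ne_eq, Nat.pair_eq_pair, not_and] at hu
    constructor <;> refine Equiv.swap_apply_of_ne_of_ne ?_ ?_ <;>
      simp only [ha, hbdef, ne_eq, Nat.pair_eq_pair, not_and] <;> omega
  have hlink' : ∀ u ∈ bs, ∀ v ∈ bs, link u v = link (τ u) (τ v) := by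
    intro u hu v _
    have huc : u ≠ c := by rintro rfl; exact hc hu
    have huc' : τ u ≠ c := fun h => huc (τ.injective (h.trans hτc.symm))
    rw [Bool.eq_iff_iff]
    constructor <;> intro h
    · obtain ⟨h1, h2⟩ := hlink u v huc h
      rwa [h1, h2]
    · obtain ⟨h1, h2⟩ := hlink _ _ huc' h
      rwa [τ.injective h1, τ.injective h2] at h
  have hmark : ∀ u k, mark R k u = mark R k (τ u) := by
    intro u
    rw [mark_eq_iff]
    by_cases hua : u = a
    · have : τ u = b := by rw [hua]; exact Equiv.swap_apply_left _ _
      rw [this, hua]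
      exact ⟨by simp [ha, hbdef], .inr ⟨hna, hnb⟩⟩
    by_cases hub : u = b
    · have : τ u = a := by rw [hub]; exact Equiv.swap_apply_right _ _
      rw [this, hub]
      exact ⟨by simp [ha, hbdef], .inr ⟨hnb, hna⟩⟩
    rw [show τ u = u from Equiv.swap_apply_of_ne_of_ne hua hub]
    exact ⟨rfl, .inl rfl⟩
  have hf₀ : IsEmbMap ((gadget R).sub bs) ((gadget R).sub (c :: bs)) id :=
    isEmbMap_gadget_of_subset (List.subset_cons_self _ _)
  have hf₁ : IsEmbMap ((gadget R).sub bs) ((gadget R).sub (c :: bs.map τ)) τ :=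
    isEmbMap_gadget_sub_iff.2 ⟨fun x hx => List.mem_cons_of_mem _ (List.mem_map_of_mem hx),
      fun x _ y _ h => τ.injective h, fun x _ => hmark x, hlink'⟩
  obtain ⟨D, hD, g₀, g₁, hg₀, hg₁, hg⟩ := hb.2 _ (mem_gadgetAge_cls.2 ⟨_, _, .refl _⟩) _
    (mem_gadgetAge_cls.2 ⟨_, _, .refl _⟩) _ _ hf₀ hf₁
  obtain ⟨ds, φ, hφ, -⟩ := mem_gadgetAge_cls.1 hD
  have hguard : ∀ w, w = a ∨ w = b → guard R w = c := by
    rintro w (rfl | rfl)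
    · rw [guard_eq (N := N) hR (by simpa [ha] using hN)]; simp [ha, hcdef]
    · rw [guard_eq (N := N) hR (by simpa [hbdef] using hN)]; simp [hbdef, hcdef]
  have hτy : (τ y = a ∨ τ y = b) ∧ τ y ≠ y := by
    rcases hy' with rfl | rfl
    · rw [show τ a = b from Equiv.swap_apply_left _ _]
      exact ⟨.inr rfl, hab.symm⟩
    · rw [show τ b = a from Equiv.swap_apply_right _ _]
      exact ⟨.inl rfl, hab⟩
  have h0 := (hg₀.comp hφ).apply_eq_of_guard_mem hR (List.mem_cons_of_mem _ hy)
    (by rw [hguard y hy']; exact List.mem_cons_self)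
  have h1 := (hg₁.comp hφ).apply_eq_of_guard_mem hR
    (List.mem_cons_of_mem _ (List.mem_map_of_mem (f := τ) hy))
    (by rw [hguard _ hτy.1]; exact List.mem_cons_self)
  have := hg y (mem_gadget_sub.2 hy)
  simp only [id] at this
  simp only [this] at h0
  exact hτy.2 (h1.symm.trans h0)

/-! ### Computability of the gadget -/

/-- Boolean list inclusion. -/
def subList (as bs : List ℕ) : Bool :=
  as.findIdx (fun x => !decide (bs.idxOf x < bs.length)) == as.length

theorem subList_iff {as bs : List ℕ} : subList as bs = true ↔ ∀ x ∈ as, x ∈ bs := by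
  simp only [subList, beq_iff_eq, List.findIdx_eq_length, Bool.not_eq_false', decide_eq_true_eq,
    List.idxOf_lt_length_iff]

theorem primrec_subList : Primrec₂ subList := by
  have h : Primrec₂ fun (p : List ℕ × List ℕ) (x : ℕ) =>
      !decide (p.2.idxOf x < p.2.length) := by
    refine Primrec.not.comp (PrimrecPred.decide (Primrec.nat_lt.comp ?_ ?_))
    · exact Primrec.list_idxOf.comp Primrec.snd (Primrec.snd.comp Primrec.fst)
    · exact Primrec.list_length.comp (Primrec.snd.comp Primrec.fst)
  exact Primrec.beq.comp (Primrec.list_findIdx Primrec.fst h) (Primrec.list_length.comp Primrec.fst)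

theorem primrec_gadgetRel {R : ℕ → ℕ → ℕ → Bool}
    (hp : Primrec fun p : ℕ × ℕ × ℕ => R p.1 p.2.1 p.2.2) : Primrec₂ (gadgetRel R) := by
  have u1 : Primrec fun n : ℕ => n.unpair.1 := Primrec.fst.comp Primrec.unpair
  have u2 : Primrec fun n : ℕ => n.unpair.2 := Primrec.snd.comp Primrec.unpair
  have modTwo : Primrec fun n : ℕ => n % 2 := Primrec.nat_mod.comp .id (.const 2)
  have hlink : Primrec₂ link :=
    Primrec.and.comp (Primrec.beq.comp (modTwo.comp (u2.comp .fst)) (.const 1))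
      (Primrec.beq.comp .snd (Primrec₂.natPair.comp (u1.comp .fst) (Primrec.succ.comp (u2.comp .fst))))
  have hsees : Primrec₂ (sees R) :=
    Primrec.or.comp (Primrec.beq.comp (modTwo.comp (u2.comp .fst)) (.const 1))
      (Primrec.and.comp (Primrec.not.comp (Primrec.beq.comp (u2.comp .fst) (.const 0)))
        (Primrec.not.comp (hp.comp (Primrec.pair (u1.comp .fst) (Primrec.pair
          (Primrec.nat_sub.comp (Primrec.nat_div.comp (u2.comp .fst) (.const 2)) (.const 1))
          .snd)))))
  have hmark : Primrec₂ (mark R) :=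
    Primrec.cond (Primrec.beq.comp (u1.comp .fst) (.const 0))
      (Primrec.beq.comp (u1.comp .snd) (u2.comp .fst))
      (Primrec.and.comp
        (Primrec.beq.comp .snd (Primrec.nat_sub.comp (u1.comp .fst) (.const 1)))
        (hsees.comp .snd (u2.comp .fst)))
  have hget : ∀ k, Primrec fun p : ℕ × List ℕ => p.2.getD k 0 := fun k =>
    (Primrec.list_getD 0).comp .snd (.const k)
  have hlen : ∀ k, Primrec fun p : ℕ × List ℕ => p.2.length == k := fun k =>
    Primrec.beq.comp (Primrec.list_length.comp .snd) (.const k)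
  exact Primrec.cond (Primrec.beq.comp .fst (.const 0))
    (Primrec.and.comp (hlen 2) (hlink.comp (hget 0) (hget 1)))
    (Primrec.and.comp (hlen 1)
      (hmark.comp (Primrec.nat_sub.comp .fst (.const 1)) (hget 0)))

theorem computableRep_gadgetLang : gadgetLang.ComputableRep :=
  ⟨.of_primrec (Primrec.encode.comp (Primrec.option_some.comp
    (Primrec.ite (Primrec.eq.comp .id (.const 0)) (.const 2) (.const 1)))) _,
    .of_primrec (Primrec.const _) _⟩

theorem strComputableIn_gadget {R : ℕ → ℕ → ℕ → Bool}
    (hp : Primrec fun p : ℕ × ℕ × ℕ => R p.1 p.2.1 p.2.2) (s : Set ℕ) :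
    StrComputableIn s (gadget R) := by
  refine ⟨.of_primrec (.const true) (fun _ => by simp [gadget]) s,
    .of_primrec ((primrec_gadgetRel hp).comp (Primrec.fst.comp Primrec.unpair)
      ((Primrec.ofNat (List ℕ)).comp (Primrec.snd.comp Primrec.unpair))) (fun n => ?_) s,
    .of_primrec (.const false) (fun n => ?_) s⟩
  · constructor
    · rintro ⟨r, as, -, h, rfl⟩
      change gadgetRel R r as = true at h
      simpa using h
    · exact fun h => ⟨_, _, fun _ _ => trivial, h, by simp⟩
  · simp [gadgetLang]

theorem strComputableIn_gadget_sub {R : ℕ → ℕ → ℕ → Bool}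
    (hp : Primrec fun p : ℕ × ℕ × ℕ => R p.1 p.2.1 p.2.2) (l : List ℕ) (s : Set ℕ) :
    StrComputableIn s ((gadget R).sub l) := by
  have ho : Primrec fun n : ℕ => Denumerable.ofNat (List ℕ) n.unpair.2 :=
    (Primrec.ofNat (List ℕ)).comp (Primrec.snd.comp Primrec.unpair)
  refine ⟨.of_primrec (primrec_subList.comp
      (Primrec.list_cons.comp .id (.const [])) (.const l)) (fun n => ?_) s,
    .of_primrec (Primrec.and.comp ((primrec_gadgetRel hp).comp
      (Primrec.fst.comp Primrec.unpair) ho) (primrec_subList.comp ho (.const l))) (fun n => ?_) s,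
    .of_primrec (.const false) (fun n => ?_) s⟩
  · rw [mem_gadget_sub, subList_iff]
    simp
  · rw [Bool.and_eq_true, subList_iff]
    constructor
    · rintro ⟨r, as, h, h', rfl⟩
      simpa using ⟨h'.1, fun x hx => mem_gadget_sub.1 (h x hx)⟩
    · exact fun h => ⟨_, _, fun x hx => mem_gadget_sub.2 (h.2 x hx),
        ⟨h.1, fun x hx => mem_gadget_sub.2 (h.2 x hx)⟩, by simp⟩
  · simp [gadgetLang]

/-- The decision procedure for the diagram of the canonical age. -/
def diagTest (R : ℕ → ℕ → ℕ → Bool) (t i w : ℕ) : Bool :=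
  bif t == 0 then w == i.unpair.1
  else bif t == 1 then subList [w] (Denumerable.ofNat (List ℕ) i.unpair.1)
  else subList (Denumerable.ofNat (List ℕ) w.unpair.2) (Denumerable.ofNat (List ℕ) i.unpair.1) &&
    bif t == 2 then gadgetRel R w.unpair.1 (Denumerable.ofNat (List ℕ) w.unpair.2)
    else t == 3 && (Denumerable.ofNat (List ℕ) w.unpair.2).length ==
      (if w.unpair.1 = 0 then 2 else 1) &&
      !gadgetRel R w.unpair.1 (Denumerable.ofNat (List ℕ) w.unpair.2)

theorem mem_diag_gadgetAge {R : ℕ → ℕ → ℕ → Bool} {t i w : ℕ} :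
    Nat.pair t (Nat.pair i w) ∈ (gadgetAge R).diag ↔ diagTest R t i w = true := by
  have hT : ∀ j as, TupleIn ((gadgetAge R).str j) as ↔
      subList as (Denumerable.ofNat (List ℕ) j.unpair.1) = true := fun j as => by
    rw [subList_iff]
    exact forall₂_congr fun x _ => mem_gadget_sub
  have hr : ∀ j r as, TupleIn ((gadgetAge R).str j) as →
      (((gadgetAge R).str j).rel r as ↔ gadgetRel R r as = true) :=
    fun j r as h => and_iff_left h
  have hlen : ∀ r k, gadgetLang.relArity r = some k ↔ k = if r = 0 then 2 else 1 :=
    fun r k => by rw [eq_comm (a := k)]; exact Option.some_inj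
  have hw : ∀ (as : List ℕ) (r : ℕ), w = Nat.pair r (Encodable.encode as) ↔
      r = w.unpair.1 ∧ as = Denumerable.ofNat (List ℕ) w.unpair.2 := fun as r => by
    constructor
    · rintro rfl; simp
    · rintro ⟨rfl, rfl⟩; simp
  simp only [CompAge.diag, Set.mem_union, Set.mem_ofPred_eq, Nat.pair_eq_pair, hw]
  constructor
  · rintro ((((⟨j, rfl, rfl, rfl⟩ | ⟨j, x, hx, rfl, rfl, rfl⟩) | ⟨j, r, as, h1, h2, rfl, rfl, rfl, rfl⟩) |
      ⟨j, r, as, h1, h2, h3, rfl, rfl, rfl, rfl⟩) | ⟨j, f, as, b, -, h, -⟩)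
    · simp [diagTest, gadgetAge]
    · simpa [diagTest, subList_iff] using mem_gadget_sub.1 hx
    · rw [hr _ _ _ h1] at h2
      rw [hT] at h1
      simp [diagTest, h1, h2]
    · rw [hr _ _ _ h1] at h3
      rw [hT] at h1
      rw [hlen] at h2
      simp [diagTest, h1, h2, h3]
    · simp [gadgetLang] at h
  · intro h
    by_cases h0 : t = 0
    · subst h0
      exact .inl (.inl (.inl (.inl ⟨i, rfl, rfl, by simpa [diagTest, gadgetAge] using h⟩)))
    by_cases h1 : t = 1
    · subst h1
      refine .inl (.inl (.inl (.inr ⟨i, w, mem_gadget_sub.2 ?_, rfl, rfl, rfl⟩)))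
      simpa [diagTest, subList_iff] using h
    simp only [diagTest, beq_eq_false_iff_ne.2 h0, beq_eq_false_iff_ne.2 h1, cond_false,
      Bool.and_eq_true] at h
    obtain ⟨hs, h⟩ := h
    rw [← hT] at hs
    by_cases h2 : t = 2
    · subst h2
      exact .inl (.inl (.inr ⟨i, _, _, hs, (hr _ _ _ hs).2 (by simpa using h), rfl, rfl, rfl, rfl⟩))
    · simp only [beq_eq_false_iff_ne.2 h2, cond_false, Bool.and_eq_true, beq_iff_eq,
        Bool.not_eq_true'] at h
      obtain ⟨⟨rfl, hl⟩, h⟩ := h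
      refine .inl (.inr ⟨i, _, _, hs, (hlen _ _).2 hl, ?_, rfl, rfl, rfl, rfl⟩)
      rw [hr _ _ _ hs, h]
      exact Bool.false_ne_true

theorem ageComputableIn_gadgetAge {R : ℕ → ℕ → ℕ → Bool}
    (hp : Primrec fun p : ℕ × ℕ × ℕ => R p.1 p.2.1 p.2.2) (s : Set ℕ) :
    AgeComputableIn s (gadgetAge R) := by
  refine ⟨.of_primrec (p := fun n => diagTest R n.unpair.1 n.unpair.2.unpair.1
    n.unpair.2.unpair.2) ?_ (fun n => ?_) s, fun i => strComputableIn_gadget_sub hp _ s⟩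
  · have u1 : Primrec fun n : ℕ => n.unpair.1 := Primrec.fst.comp Primrec.unpair
    have u2 : Primrec fun n : ℕ => n.unpair.2 := Primrec.snd.comp Primrec.unpair
    have ho := Primrec.ofNat (List ℕ)
    have hw : Primrec fun n : ℕ => n.unpair.2.unpair.2 := u2.comp u2
    have hi := ho.comp (u1.comp (u1.comp u2))
    have ha := ho.comp (u2.comp hw)
    have hg := (primrec_gadgetRel hp).comp (u1.comp hw) ha
    have ht : ∀ k, Primrec fun n : ℕ => n.unpair.1 == k := fun k => Primrec.beq.comp u1 (.const k)
    exact Primrec.cond (ht 0) (Primrec.beq.comp hw (u1.comp (u1.comp u2)))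
      (Primrec.cond (ht 1) (primrec_subList.comp (Primrec.list_cons.comp hw (.const [])) hi)
        (Primrec.and.comp (primrec_subList.comp ha hi)
          (Primrec.cond (ht 2) hg
            (Primrec.and.comp (Primrec.and.comp (ht 3)
              (Primrec.beq.comp (Primrec.list_length.comp ha)
                (Primrec.ite (Primrec.eq.comp (u1.comp hw) (.const 0)) (.const 2) (.const 1))))
              (Primrec.not.comp hg)))))
  · rw [← mem_diag_gadgetAge, Nat.pair_unpair, Nat.pair_unpair]

theorem isCanonicalAgeOf_gadgetAge (R : ℕ → ℕ → ℕ → Bool) (s : Set ℕ) :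
    IsCanonicalAgeOf s (gadgetAge R) (gadget R) := by
  refine ⟨.of_primrec (Primrec.encode.comp ((Primrec.ofNat (List ℕ)).comp
    (Primrec.fst.comp Primrec.unpair))) s, fun _ _ _ => trivial, fun as _ n =>
    ⟨Nat.pair (Encodable.encode as) n, Nat.right_le_pair _ _, ?_⟩, fun _ => rfl⟩
  simp [gadgetAge]

/-! ### Extracting a bound from the cofinal amalgamation property -/

/-- The function with finite prefix `τ`. -/
def ofPfx (τ z : ℕ) : ℕ := (Denumerable.ofNat (List ℕ) τ).getD z 0

theorem ofPfx_pfx {O : ℕ → ℕ} {l z : ℕ} (h : z < l) : ofPfx (pfx O l) z = O z := by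
  simp [ofPfx, pfx, h]

theorem primrec_ofPfx : Primrec₂ ofPfx :=
  (Primrec.list_getD 0).comp ((Primrec.ofNat (List ℕ)).comp .fst) .snd

theorem TotalComputableIn.comp_pfx {s : Set ℕ} {O a b : ℕ → ℕ} (hO : TotalComputableIn s O)
    (ha : TotalComputableIn s a) (hb : TotalComputableIn s b) {F : ℕ → ℕ → ℕ} (hF : Primrec₂ F) :
    TotalComputableIn s fun n => F (CFL.pfx O (b n)) (a n) := by
  have hF' : Primrec fun n : ℕ => F n.unpair.1 n.unpair.2 :=
    hF.comp (Primrec.fst.comp Primrec.unpair) (Primrec.snd.comp Primrec.unpair)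
  have := (TotalComputableIn.of_primrec hF' s).comp ((hO.pfx.comp hb).pair ha)
  simpa only [Nat.unpair_pair] using this

theorem totalComputableIn_bit_self (s : Set ℕ) : TotalComputableIn s (bit s) :=
  ⟨.oracle, fun _ => rfl⟩

theorem le_encode_of_mem {x : ℕ} {l : List ℕ} (h : x ∈ l) : x ≤ Encodable.encode l := by
  induction l with
  | nil => simp at h
  | cons a l ih =>
    rw [Encodable.encode_list_cons]
    rcases List.mem_cons.1 h with rfl | h
    · exact (Nat.left_le_pair _ _).trans (Nat.le_succ _)
    · exact (ih h).trans ((Nat.right_le_pair _ _).trans (Nat.le_succ _))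

/-- The distinguished embeddings of the substructure generated by `Nat.pair e 0` locate the
index `N` with `∀ m, R e N m`. -/
theorem le_of_isEmb {R : ℕ → ℕ → ℕ → Bool} (hR : AtMostOne R) {F : PotEmb} {e N : ℕ}
    (hi : F.i = Nat.pair (Encodable.encode [Nat.pair e 0]) 0) (hF : F.IsEmb (gadgetAge R))
    (hb : AmalgBase (gadgetAge R).cls ((gadgetAge R).str F.j)) (hN : ∀ m, R e N m = true) :
    N ≤ F.j.unpair.1 := by
  obtain ⟨h, -, ⟨h1, -, h3, -⟩, -⟩ := hF
  have htup : (gadgetAge R).tup F.i = [Nat.pair e 0] := by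
    rw [hi]
    simp only [gadgetAge, Nat.unpair_pair, Denumerable.ofNat_encode]
  have hstr : (gadgetAge R).str F.i = (gadget R).sub [Nat.pair e 0] :=
    congrArg (gadget R).sub htup
  rw [htup, hstr] at h1 h3
  have ha : InClosure ((gadget R).sub [Nat.pair e 0]) [Nat.pair e 0] (Nat.pair e 0) :=
    inClosure_gadget_iff.2 ⟨by simp, mem_gadget_sub.2 (by simp)⟩
  have hy := h1 _ ha
  have hy' : h (Nat.pair e 0) ∈ Denumerable.ofNat (List ℕ) F.j.unpair.1 :=
    mem_gadget_sub.1 hy.mem_dom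
  have hmark : ∀ k, mark R k (Nat.pair e 0) = mark R k (h (Nat.pair e 0)) := by
    intro k
    have := h3 (k + 1) [Nat.pair e 0] (List.forall_mem_singleton.2 ha)
    rw [← gadgetRel_succ, ← gadgetRel_succ, Bool.eq_iff_iff]
    constructor
    · intro hk
      exact (this.1 ⟨⟨hk, List.forall_mem_singleton.2 ha.mem_dom⟩, List.forall_mem_singleton.2 ha⟩).1.1
    · intro hk
      exact (this.2 ⟨⟨hk, List.forall_mem_singleton.2 hy.mem_dom⟩,
        List.forall_mem_singleton.2 hy⟩).1.1
  obtain ⟨he, hne⟩ := mark_eq_iff.1 hmark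
  have hna : ¬ Named R (Nat.pair e 0) := not_named_iff.2 (by simp)
  have hny : ¬ Named R (h (Nat.pair e 0)) := by
    rcases hne with hne | hne
    · rwa [← hne]
    · exact hne.2
  rw [not_named_iff, ← he, Nat.unpair_pair] at hny
  have hmem := mem_of_amalgBase hR hN hb hy' (hny.imp_right fun ⟨N', hN', hw⟩ => by
    rwa [hR _ _ _ hN hN'])
  have := le_encode_of_mem hmem
  rw [Denumerable.encode_ofNat] at this
  have h2 := Nat.right_le_pair e (2 * N + 1)
  omega

theorem exists_bound_of_ccoAP {R : ℕ → ℕ → ℕ → Bool} (hR : AtMostOne R) {s : Set ℕ}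
    (h : CcoAP s (gadgetAge R)) :
    ∃ f, TotalComputableIn s f ∧ ∀ e N, (∀ m, R e N m = true) → N ≤ f e := by
  obtain ⟨W, ⟨hW, -, -, hcov⟩, ⟨c, hc⟩, -⟩ := h
  set p : ℕ → ℕ → Bool := fun e y =>
    y.unpair.1.unpair.1 == Nat.pair (Encodable.encode [Nat.pair e 0]) 0 &&
      haltsBy (bit s) y.unpair.2 (Nat.pair c.encodeCode y.unpair.1) with hp
  have u1 : Primrec fun n : ℕ => n.unpair.1 := Primrec.fst.comp Primrec.unpair
  have u2 : Primrec fun n : ℕ => n.unpair.2 := Primrec.snd.comp Primrec.unpair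
  have hcomp : TotalComputableIn s fun n => (p n.unpair.1 n.unpair.2).toNat := by
    have hq : Primrec₂ fun τ n : ℕ =>
        (n.unpair.2.unpair.1.unpair.1 ==
            Nat.pair (Encodable.encode [Nat.pair n.unpair.1 0]) 0 &&
          haltsBy (ofPfx τ) n.unpair.2.unpair.2
            (Nat.pair c.encodeCode n.unpair.2.unpair.1)).toNat := by
      have hy : Primrec fun q : ℕ × ℕ => q.2.unpair.2 := u2.comp .snd
      exact ((Primrec.cond (Primrec.and.comp (Primrec.beq.comp (u1.comp (u1.comp hy))
        (Primrec₂.natPair.comp (Primrec.encode.comp (Primrec.list_cons.comp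
          (Primrec₂.natPair.comp (u1.comp .snd) (.const 0)) (.const []))) (.const 0)))
        (primrec_haltsBy (primrec_ofPfx.comp₂ (Primrec.fst.comp₂ .left) .right) (u2.comp hy)
          (Primrec₂.natPair.comp (.const c.encodeCode) (u1.comp hy)))) (.const 1) (.const 0)).of_eq
            fun _ => rfl)
    have := (totalComputableIn_bit_self s).comp_pfx (.of_primrec .id s) (.of_primrec u2 s) hq
    convert this using 2 with n
    refine congrArg (fun v => (_ && v).toNat) ?_
    exact haltsBy_congr fun z hz => (ofPfx_pfx (hz.trans_le (Nat.unpair_right_le _))).symm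
  obtain ⟨f, hf, hpf⟩ := TotalComputableIn.exists_search hcomp fun e => by
    obtain ⟨F, hF, hFi⟩ := hcov (Nat.pair (Encodable.encode [Nat.pair e 0]) 0)
    obtain ⟨j, hj⟩ := dom_eval_iff_haltsBy.1 ((hc F.code).1 ⟨F, hF, rfl⟩)
    refine ⟨Nat.pair F.code j, ?_⟩
    simp only [hp, Nat.unpair_pair, hj, Bool.and_true, beq_iff_eq]
    rw [PotEmb.code, Nat.unpair_pair, hFi]
  refine ⟨fun e => (f e).unpair.1.unpair.2.unpair.1.unpair.1,
    (TotalComputableIn.of_primrec (u1.comp (u1.comp (u2.comp u1))) s).comp hf, fun e N hN => ?_⟩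
  have h := hpf e
  simp only [hp, Bool.and_eq_true, beq_iff_eq] at h
  obtain ⟨F, hF, hFc⟩ := (hc _).2 (dom_eval_iff_haltsBy.2 ⟨_, h.2⟩)
  obtain ⟨-, hemb, hbase⟩ := hW F hF
  rw [hFc, PotEmb.code, Nat.unpair_pair] at h
  have := le_of_isEmb hR h.1 hemb hbase hN
  simpa only [hFc, PotEmb.code, Nat.unpair_pair] using this

/-! ### Limit approximations of iterated jumps -/

/-- The least `j < t` with `haltsBy O j x`, or else `t`. -/
noncomputable def firstHalt (O : ℕ → ℕ) (t x : ℕ) : ℕ :=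
  (List.range t).findIdx fun j => haltsBy O j x

theorem firstHalt_le (O : ℕ → ℕ) (t x : ℕ) : firstHalt O t x ≤ t :=
  List.findIdx_le_length.trans_eq List.length_range

theorem firstHalt_lt_iff {O : ℕ → ℕ} {t x : ℕ} :
    firstHalt O t x < t ↔ ∃ j < t, haltsBy O j x = true := by
  conv_lhs => rhs; rw [← List.length_range (n := t)]
  rw [firstHalt, List.findIdx_lt_length]
  simp

theorem firstHalt_eq {O : ℕ → ℕ} {j t x : ℕ} (hjt : j < t) (hj : haltsBy O j x = true)
    (hlt : ∀ i < j, haltsBy O i x = false) : firstHalt O t x = j := by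
  rw [firstHalt, List.findIdx_eq (by simpa using hjt)]
  simpa [hj] using hlt

theorem firstHalt_lt_congr {O O' : ℕ → ℕ} {t x : ℕ} (h : ∀ y < t, O y = O' y) :
    firstHalt O t x < t ↔ firstHalt O' t x < t := by
  rw [firstHalt_lt_iff, firstHalt_lt_iff]
  refine exists_congr fun j => and_congr_right fun hj => ?_
  rw [haltsBy_congr fun y hy => h y (hy.trans hj)]

theorem primrec_firstHalt {α : Type*} [Primcodable α] {O : α → ℕ → ℕ} {f g : α → ℕ}
    (hO : Primrec₂ O) (hf : Primrec f) (hg : Primrec g) :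
    Primrec fun a => firstHalt (O a) (f a) (g a) :=
  Primrec.list_findIdx (Primrec.list_range.comp hf)
    (primrec_haltsBy (hO.comp (Primrec.fst.comp .fst) .snd) .snd (hg.comp .fst))

/-- An approximation to the characteristic function of `∅` or, if `k ≠ 0`, of `0'`. -/
noncomputable def approx (k t y : ℕ) : ℕ :=
  if k = 0 then 0 else if firstHalt (fun _ => 0) t y < t then 1 else 0

/-- An approximation to the least halting time of the computation coded by `e.unpair.2` relative to
`∅` or `0'`. -/
noncomputable def haltGuess (e t : ℕ) : ℕ := firstHalt (approx e.unpair.1 t) t e.unpair.2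

/-- The guess is the same at stages `N` and `N + m`, and `N` begins a run of equal guesses. -/
noncomputable def runStart (e N m : ℕ) : Bool :=
  haltGuess e (N + m) == haltGuess e N &&
    (N == 0 || !(haltGuess e (N - 1) == haltGuess e N))

theorem primrec_haltGuess : Primrec₂ haltGuess := by
  have u1 : Primrec fun n : ℕ => n.unpair.1 := Primrec.fst.comp Primrec.unpair
  have u2 : Primrec fun n : ℕ => n.unpair.2 := Primrec.snd.comp Primrec.unpair
  have ht : Primrec fun q : (ℕ × ℕ) × ℕ => q.1.2 := Primrec.snd.comp .fst
  refine primrec_firstHalt ?_ .snd (u2.comp .fst)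
  exact Primrec.ite (Primrec.eq.comp (u1.comp (Primrec.fst.comp .fst)) (.const 0)) (.const 0)
    (Primrec.ite (Primrec.nat_lt.comp (primrec_firstHalt (.const 0) ht .snd) ht)
      (.const 1) (.const 0))

theorem primrec_runStart : Primrec fun p : ℕ × ℕ × ℕ => runStart p.1 p.2.1 p.2.2 := by
  have hN : Primrec fun p : ℕ × ℕ × ℕ => p.2.1 := Primrec.fst.comp .snd
  have hgN := primrec_haltGuess.comp .fst hN
  exact Primrec.and.comp
    (Primrec.beq.comp (primrec_haltGuess.comp .fst
      (Primrec.nat_add.comp hN (Primrec.snd.comp .snd))) hgN)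
    (Primrec.or.comp (Primrec.beq.comp hN (.const 0)) (Primrec.not.comp (Primrec.beq.comp
      (primrec_haltGuess.comp .fst (Primrec.nat_sub.comp hN (.const 1))) hgN)))

theorem atMostOne_runStart : AtMostOne runStart := by
  have key : ∀ e N N', (∀ m, runStart e N m = true) → (∀ m, runStart e N' m = true) →
      ¬ N < N' := by
    intro e N N' h h' hlt
    have h1 := h (N' - N)
    have h2 := h (N' - 1 - N)
    have h3 := h' 0
    rw [runStart, show N + (N' - N) = N' by omega] at h1
    rw [runStart, show N + (N' - 1 - N) = N' - 1 by omega] at h2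
    rw [runStart] at h3
    simp only [Bool.and_eq_true, beq_iff_eq, Bool.or_eq_true, Bool.not_eq_true',
      beq_eq_false_iff_ne] at h1 h2 h3
    rcases h3.2 with h0 | h0
    · omega
    · exact h0 (h2.1.trans h1.1.symm)
  intro e N N' h h'
  exact le_antisymm (not_lt.1 (key e N' N h' h)) (not_lt.1 (key e N N' h h'))

theorem exists_runStart {e v t : ℕ} (h : ∀ t' ≥ t, haltGuess e t' = v) :
    ∃ N, haltGuess e N = v ∧ ∀ m, runStart e N m = true := by
  have hex : ∃ N, ∀ t' ≥ N, haltGuess e t' = v := ⟨t, h⟩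
  have hspec := Nat.find_spec hex
  refine ⟨Nat.find hex, hspec _ le_rfl, fun m => ?_⟩
  rw [runStart, hspec _ (Nat.le_add_right _ _), hspec _ le_rfl]
  rcases Nat.eq_zero_or_pos (Nat.find hex) with h0 | h0
  · simp [h0]
  · have hmin := Nat.find_min hex (Nat.sub_lt h0 one_pos)
    have hne : haltGuess e (Nat.find hex - 1) ≠ v := fun hv => hmin fun t' ht' => by
      rcases ht'.eq_or_lt with rfl | hlt
      · exact hv
      · exact hspec _ (by omega)
    simp [hne]

/-- If `A` is the limit of `approx k`, then a bound on the beginnings of the final runs of guesses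
decides the jump of `A`. -/
theorem turingLE_jump {s A : Set ℕ} {f : ℕ → ℕ} {k : ℕ}
    (hlim : ∀ y, ∃ t, ∀ t' ≥ t, approx k t' y = bit A y) (hA : TuringLE A s)
    (hf : TotalComputableIn s f) (hbd : ∀ e N, (∀ m, runStart e N m = true) → N ≤ f e) :
    TuringLE (jump A) s := by
  have hmem : ∀ x, x ∈ jump A ↔
      firstHalt (bit A) (f (Nat.pair k x) + 1) x < f (Nat.pair k x) + 1 := by
    intro x
    rw [mem_jump_iff, firstHalt_lt_iff]
    refine ⟨fun h => ?_, fun ⟨j, _, hj⟩ => ⟨j, hj⟩⟩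
    set j := Nat.find h with hjdef
    have hj : haltsBy (bit A) j x = true := Nat.find_spec h
    obtain ⟨t, ht⟩ : ∃ t, ∀ y < j, ∀ t' ≥ t, approx k t' y = bit A y := by
      choose u hu using hlim
      exact ⟨(Finset.range j).sup u, fun y hy t' ht' =>
        hu y t' ((Finset.le_sup (Finset.mem_range.2 hy)).trans ht')⟩
    have hguess : ∀ t' ≥ max t (j + 1), haltGuess (Nat.pair k x) t' = j := by
      intro t' ht'
      have hap : ∀ i ≤ j, haltsBy (approx k t') i x = haltsBy (bit A) i x := fun i hi =>
        haltsBy_congr fun y hy => ht y (hy.trans_le hi) t' ((le_max_left _ _).trans ht')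
      rw [haltGuess, Nat.unpair_pair]
      refine firstHalt_eq ((le_max_right _ _).trans ht') ?_ fun i hi => ?_
      · rwa [hap j le_rfl]
      · rw [hap i hi.le]
        exact Bool.eq_false_iff.2 (Nat.find_min h hi)
    obtain ⟨N, hN, hrun⟩ := exists_runStart hguess
    exact ⟨j, Nat.lt_succ_of_le (hN ▸ (firstHalt_le _ _ _).trans (hbd _ _ hrun)), hj⟩
  unfold TuringLE at hA ⊢
  rw [setRecIn_iff] at hA ⊢
  have hb : TotalComputableIn s fun x => f (Nat.pair k x) + 1 :=
    (TotalComputableIn.of_primrec Primrec.succ s).comp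
      (hf.comp (.of_primrec (Primrec₂.natPair.comp (.const k) .id) s))
  have hF : Primrec₂ fun τ n : ℕ =>
      if firstHalt (ofPfx τ) n.unpair.2 n.unpair.1 < n.unpair.2 then 1 else 0 := by
    have u1 : Primrec fun q : ℕ × ℕ => q.2.unpair.1 :=
      Primrec.fst.comp (Primrec.unpair.comp .snd)
    have u2 : Primrec fun q : ℕ × ℕ => q.2.unpair.2 :=
      Primrec.snd.comp (Primrec.unpair.comp .snd)
    exact Primrec.ite (Primrec.nat_lt.comp
      (primrec_firstHalt (primrec_ofPfx.comp₂ (Primrec.fst.comp₂ .left) .right) u2 u1) u2)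
      (.const 1) (.const 0)
  have := hA.comp_pfx ((TotalComputableIn.of_primrec Primrec.id s).pair hb) hb hF
  convert this using 2 with x
  simp only [bit, Nat.unpair_pair, id, hmem x]
  exact if_congr (firstHalt_lt_congr fun y hy => (ofPfx_pfx hy).symm) rfl rfl

theorem bit_empty : bit ∅ = fun _ => 0 := by
  funext n
  simp [bit]

theorem exists_approx_zero (y : ℕ) : ∃ t, ∀ t' ≥ t, approx 0 t' y = bit ∅ y :=
  ⟨0, fun _ _ => by simp [approx, bit_empty]⟩

theorem exists_approx_one (y : ℕ) : ∃ t, ∀ t' ≥ t, approx 1 t' y = bit zeroJump y := by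
  by_cases hy : y ∈ zeroJump
  · obtain ⟨j, hj⟩ := mem_jump_iff.1 hy
    rw [bit_empty] at hj
    refine ⟨j + 1, fun t' ht' => ?_⟩
    simp [approx, bit, hy, firstHalt_lt_iff.2 ⟨j, ht', hj⟩]
  · refine ⟨0, fun t' _ => ?_⟩
    have : ¬ firstHalt (fun _ => 0) t' y < t' := fun h => hy <| by
      obtain ⟨j, -, hj⟩ := firstHalt_lt_iff.1 h
      exact mem_jump_iff.2 ⟨j, by rwa [bit_empty]⟩
    simp [approx, bit, hy, this]

/-- There is a computable age `𝕂`, the canonical computable age of a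
computable structure, which has coAP but such that `CcoAP(s)` implies `0'' ≤_T s`. -/
theorem lower_bound_coAP_infinite_language :
    ∃ L : Lang, L.ComputableRep ∧
    ∃ M : Str L, StrComputableIn ∅ M ∧
    ∃ K : CompAge L, AgeComputableIn ∅ K ∧ IsCanonicalAgeOf ∅ K M ∧
      CoAP K.cls ∧
      ∀ s : Set ℕ, CcoAP s K → TuringLE zeroJump2 s := by
  refine ⟨gadgetLang, computableRep_gadgetLang, gadget runStart,
    strComputableIn_gadget primrec_runStart _, gadgetAge runStart,
    ageComputableIn_gadgetAge primrec_runStart _, isCanonicalAgeOf_gadgetAge _ _,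
    coAP_gadgetAge atMostOne_runStart, fun s hs => ?_⟩
  obtain ⟨f, hf, hbd⟩ := exists_bound_of_ccoAP atMostOne_runStart hs
  have h0 : TuringLE ∅ s := SetRecIn.of_primrec (.const false) (fun _ => by simp) s
  exact turingLE_jump exists_approx_one (turingLE_jump exists_approx_zero h0 hf hbd) hf hbd

end CFL
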